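/- Let Θ₀ > 0, T > 0, and let v : ℝ × (0,T) → ℝ be a smooth, strictly positive solution of the nonlocal rescaled DLSS equation ∂_τ v = −(1/I(v(·,τ))) ∂_y²( v ∂_y²(ln v) ) + (2/Θ₀) ∂_y( y v ), such that for every τ the function v(·,τ) is a probability density which, together with all its spatial derivatives, decays faster than any polynomial as |y| → ∞, has Fisher information I(v(·,τ)) ∈ (0,∞), and has second moment ∫_ℝ y² v(y,τ) dy = Θ₀. Define the relative Boltzmann entropy H(v(·,τ)|B₁) = (1/2) ln(2π e Θ₀) + ∫_ℝ v(y,τ) ln v(y,τ) dy, where B₁ is the centered Gaussian density of second moment Θ₀. Then for every τ ∈ (0,T): (d/dτ) H(v(·,τ)|B₁) ≤ −(2/Θ₀) ( exp( 2 H(v(·,τ)|B₁) ) − 1 ). -/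

import Mathlib

open MeasureTheory Filter Set

/-- The `p`-logarithm: `ln_p u = (u^(p-1) - 1)/(p-1)` for `p ≠ 1`, and `ln u` for `p = 1`. -/
noncomputable def lnp (p : ℝ) (u : ℝ) : ℝ :=
  if p = 1 then Real.log u else (u ^ (p - 1) - 1) / (p - 1)

/-- Generalized Fisher information `I_p(f) = (1/2) ∫ f ((ln_p f)')²`. -/
noncomputable def fisherP (p : ℝ) (f : ℝ → ℝ) : ℝ :=
  (1 / 2) * ∫ x : ℝ, f x * (deriv (fun y => lnp p (f y)) x) ^ 2

/-- Rényi entropy of order `p ≠ 1`: `R_p(f) = (1/(1-p)) ln ∫ f^p`. -/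
noncomputable def renyi (p : ℝ) (f : ℝ → ℝ) : ℝ :=
  (1 / (1 - p)) * Real.log (∫ x : ℝ, f x ^ p)

/-- `f`, together with all its derivatives, decays faster than any polynomial at infinity. -/
def RapidDecay (f : ℝ → ℝ) : Prop :=
  ∀ n k : ℕ, Tendsto (fun x => x ^ n * iteratedDeriv k f x) (cocompact ℝ) (nhds 0)

/-- The classical Fisher information `I(f) = (1/2) ∫ f ((ln f)')²`. -/
noncomputable def fisher (f : ℝ → ℝ) : ℝ :=
  (1 / 2) * ∫ y : ℝ, f y * (deriv (fun z => Real.log (f z)) y) ^ 2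

/-- The relative Boltzmann entropy with respect to the centered Gaussian of second
moment `Θ₀`: `H(f|B₁) = (1/2) ln(2πeΘ₀) + ∫ f ln f`. -/
noncomputable def relBoltzmann (Θ₀ : ℝ) (f : ℝ → ℝ) : ℝ :=
  (1 / 2) * Real.log (2 * Real.pi * Real.exp 1 * Θ₀) +
    ∫ y : ℝ, f y * Real.log (f y)

open Topology

/-- `k` is a cutoff function equal to `1` on `[-r, r]` and to `0` outside `[-2r, 2r]`, with first
and second derivatives `k1` and `k2` bounded by `A / r`. -/
structure IsCutoff (A r : ℝ) (k k1 k2 : ℝ → ℝ) : Prop where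
  d0 : ∀ y, HasDerivAt k (k1 y) y
  d1 : ∀ y, HasDerivAt k1 (k2 y) y
  cont2 : Continuous k2
  nonneg : ∀ y, 0 ≤ k y
  le_one : ∀ y, k y ≤ 1
  abs1 : ∀ y, |k1 y| ≤ A / r
  abs2 : ∀ y, |k2 y| ≤ A / r
  eq_one : ∀ y, |y| ≤ r → k y = 1
  vanish : ∀ y, 2 * r < |y| → k y = 0 ∧ k1 y = 0 ∧ k2 y = 0

namespace IsCutoff

variable {A r : ℝ} {k k1 k2 : ℝ → ℝ}

lemma cont0 (h : IsCutoff A r k k1 k2) : Continuous k :=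
  continuous_iff_continuousAt.2 fun y => (h.d0 y).continuousAt

lemma cont1 (h : IsCutoff A r k k1 k2) : Continuous k1 :=
  continuous_iff_continuousAt.2 fun y => (h.d1 y).continuousAt

end IsCutoff

lemma deriv_eq_zero_of_forall_lt_abs {f : ℝ → ℝ} {c : ℝ} (hf : ∀ y, c < |y| → f y = 0)
    (y : ℝ) (hy : c < |y|) : deriv f y = 0 := by
  have : f =ᶠ[𝓝 y] fun _ => 0 := by
    filter_upwards [(isOpen_lt continuous_const continuous_abs).mem_nhds hy] with z hz
    exact hf z hz
  rw [this.deriv_eq, deriv_const]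

lemma exists_bound_of_vanish {f : ℝ → ℝ} {c : ℝ} (hf : Continuous f)
    (h0 : ∀ y, c < |y| → f y = 0) : ∃ A, ∀ y, |f y| ≤ A := by
  obtain ⟨A, hA⟩ := (isCompact_Icc (a := -c) (b := c)).exists_bound_of_continuousOn hf.continuousOn
  refine ⟨max A 0, fun y => ?_⟩
  by_cases hy : |y| ≤ c
  · exact (hA y (abs_le.1 hy)).trans (le_max_left _ _)
  · simp [h0 y (not_le.1 hy)]

lemma exists_cutoffs : ∃ A : ℝ, 1 ≤ A ∧ ∃ k k1 k2 : ℕ → ℝ → ℝ,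
    (∀ n, IsCutoff A (2 ^ n) (k n) (k1 n) (k2 n)) ∧ ∀ y, Monotone (fun n => k n y) := by
  let b : ContDiffBump (0 : ℝ) := ⟨1, 2, by norm_num, by norm_num⟩
  have hb : ContDiff ℝ 2 (b : ℝ → ℝ) := b.contDiff
  have hb1 : ContDiff ℝ 1 (deriv (b : ℝ → ℝ)) := by
    have : ContDiff ℝ (1 + 1) (b : ℝ → ℝ) := by simpa [one_add_one_eq_two] using hb
    exact (contDiff_succ_iff_deriv.1 this).2.2
  have d0 : ∀ y, HasDerivAt b (deriv b y) y := fun y =>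
    (hb.differentiable (by norm_num) y).hasDerivAt
  have d1 : ∀ y, HasDerivAt (deriv b) (deriv (deriv b) y) y := fun y =>
    (hb1.differentiable (by norm_num) y).hasDerivAt
  have c2 : Continuous (deriv (deriv b)) := hb1.continuous_deriv le_rfl
  have z0 : ∀ y, 2 < |y| → b y = 0 := fun y hy =>
    b.zero_of_le_dist (by simpa [b, Real.dist_eq] using hy.le)
  have z1 := deriv_eq_zero_of_forall_lt_abs z0
  have z2 := deriv_eq_zero_of_forall_lt_abs z1
  have o0 : ∀ y, |y| ≤ 1 → b y = 1 := fun y hy =>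
    b.one_of_mem_closedBall (by simpa [b, Real.dist_eq] using hy)
  obtain ⟨A1, hA1⟩ := exists_bound_of_vanish hb1.continuous z1
  obtain ⟨A2, hA2⟩ := exists_bound_of_vanish c2 z2
  set A := max 1 (max A1 A2)
  have h1A : 1 ≤ A := le_max_left _ _
  have hA1' : A1 ≤ A := (le_max_left _ _).trans (le_max_right _ _)
  have hA2' : A2 ≤ A := (le_max_right _ _).trans (le_max_right _ _)
  refine ⟨A, h1A, fun n y => b (y / 2 ^ n), fun n y => deriv b (y / 2 ^ n) / 2 ^ n,
    fun n y => deriv (deriv b) (y / 2 ^ n) / 2 ^ n / 2 ^ n, fun n => ?_, fun y => ?_⟩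
  · have hr : (0 : ℝ) < 2 ^ n := by positivity
    have hr1 : (1 : ℝ) ≤ 2 ^ n := one_le_pow₀ (by norm_num)
    have hs : ∀ y : ℝ, HasDerivAt (fun y : ℝ => y / 2 ^ n) (1 / 2 ^ n) y := fun y =>
      (hasDerivAt_id y).div_const _
    have habs : ∀ y : ℝ, |y / 2 ^ n| = |y| / 2 ^ n := fun y => by rw [abs_div, abs_of_pos hr]
    have hv : ∀ y : ℝ, 2 * 2 ^ n < |y| → 2 < |y / 2 ^ n| := fun y hy => by
      rw [habs, lt_div_iff₀ hr]; exact hy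
    refine ⟨fun y => ?_, fun y => ?_, by fun_prop, fun y => b.nonneg, fun y => b.le_one,
      fun y => ?_, fun y => ?_, fun y hy => ?_, fun y hy => ?_⟩
    · simpa [div_eq_mul_inv, Function.comp_def] using (d0 (y / 2 ^ n)).comp y (hs y)
    · simpa [div_eq_mul_inv, Function.comp_def] using
        ((d1 (y / 2 ^ n)).comp y (hs y)).div_const (2 ^ n)
    · rw [abs_div, abs_of_pos hr]
      gcongr
      exact (hA1 _).trans hA1'
    · rw [abs_div, abs_div, abs_of_pos hr]
      have : |deriv (deriv b) (y / 2 ^ n)| / 2 ^ n ≤ A / 1 := by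
        gcongr
        exact (hA2 _).trans hA2'
      gcongr
      simpa using this
    · exact o0 _ (by rw [habs]; exact (div_le_one hr).2 hy)
    · simp [z0 _ (hv y hy), z1 _ (hv y hy), z2 _ (hv y hy)]
  · refine monotone_nat_of_le_succ fun n => ?_
    have hr : (0 : ℝ) < 2 ^ n := by positivity
    by_cases hy : |y / 2 ^ n| ≤ 2
    · have : b (y / 2 ^ (n + 1)) = 1 := by
        apply o0
        have : y / 2 ^ (n + 1) = y / 2 ^ n / 2 := by rw [pow_succ]; field_simp
        rw [this, abs_div, abs_two]; linarith
      change b (y / 2 ^ n) ≤ b (y / 2 ^ (n + 1))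
      rw [this]; exact b.le_one
    · change b (y / 2 ^ n) ≤ b (y / 2 ^ (n + 1))
      rw [z0 _ (not_le.1 hy)]; exact b.nonneg

lemma integrable_of_vanish {f : ℝ → ℝ} {c : ℝ} (hf : Continuous f)
    (h0 : ∀ y, c < |y| → f y = 0) : Integrable f := by
  refine hf.integrable_of_hasCompactSupport (HasCompactSupport.intro (isCompact_Icc (a := -c)
    (b := c)) fun y hy => h0 y ?_)
  by_contra h
  exact hy (abs_le.1 (not_lt.1 h))

/-- The derivative of a compactly supported function has integral zero. -/
lemma integral_deriv_eq_zero_of_vanish {g g' : ℝ → ℝ} {c : ℝ} (hg : ∀ y, HasDerivAt g (g' y) y)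
    (hg' : Continuous g') (h0 : ∀ y, c < |y| → g y = 0) : ∫ y, g' y = 0 := by
  have hgc : Continuous g := continuous_iff_continuousAt.2 fun y => (hg y).continuousAt
  have h1 : ∀ y, c < |y| → g' y = 0 := fun y hy => by
    rw [← (hg y).deriv]; exact deriv_eq_zero_of_forall_lt_abs h0 y hy
  exact integral_eq_zero_of_hasDerivAt_of_integrable hg (integrable_of_vanish hg' h1)
    (integrable_of_vanish hgc h0)

/-- Integrals against cutoffs with growing radius converge to the full integral. -/
lemma tendsto_integral_cutoff {A : ℝ} {k k1 k2 : ℕ → ℝ → ℝ}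
    (hk : ∀ n, IsCutoff A (2 ^ n) (k n) (k1 n) (k2 n)) (m : ℕ) {g : ℝ → ℝ} (hg : Integrable g) :
    Tendsto (fun n => ∫ y, k n y ^ m * g y) atTop (𝓝 (∫ y, g y)) := by
  refine tendsto_integral_of_dominated_convergence (fun y => |g y|)
    (fun n => ((hk n).cont0.pow m).aestronglyMeasurable.mul hg.1) hg.abs (fun n => ?_) ?_
  · refine Eventually.of_forall fun y => ?_
    rw [Real.norm_eq_abs, abs_mul]
    refine mul_le_of_le_one_left (abs_nonneg _) ?_
    rw [abs_of_nonneg (pow_nonneg ((hk n).nonneg y) m)]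
    exact pow_le_one₀ ((hk n).nonneg y) ((hk n).le_one y)
  · refine Eventually.of_forall fun y => tendsto_const_nhds.congr' ?_
    have : ∀ᶠ n : ℕ in atTop, |y| ≤ (2 : ℝ) ^ n :=
      (tendsto_pow_atTop_atTop_of_one_lt (by norm_num)).eventually_ge_atTop _
    filter_upwards [this] with n hn
    simp [(hk n).eq_one y hn]

lemma integrable_cutoff_mul {A r : ℝ} {k k1 k2 : ℝ → ℝ} (hk : IsCutoff A r k k1 k2) (m : ℕ)
    {g : ℝ → ℝ} (hg : Integrable g) : Integrable (fun y => k y ^ m * g y) := by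
  refine hg.mono ((hk.cont0.pow m).aestronglyMeasurable.mul hg.1)
    (Eventually.of_forall fun y => ?_)
  rw [norm_mul]
  refine mul_le_of_le_one_left (norm_nonneg _) ?_
  rw [Real.norm_of_nonneg (pow_nonneg (hk.nonneg y) m)]
  exact pow_le_one₀ (hk.nonneg y) (hk.le_one y)

lemma tendsto_div_two_pow (c : ℝ) : Tendsto (fun n : ℕ => c / (2 : ℝ) ^ n) atTop (𝓝 0) :=
  tendsto_const_nhds.div_atTop (tendsto_pow_atTop_atTop_of_one_lt (by norm_num))

/-- An integrable function dominated by the derivative of an integrable function has nonpositive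
integral. -/
lemma integral_nonpos_of_le_deriv {G B b : ℝ → ℝ} (hG : Integrable G) (hB : Integrable B)
    (hd : ∀ y, HasDerivAt B (b y) y) (hb : Continuous b) (hle : ∀ y, G y ≤ b y) :
    ∫ y, G y ≤ 0 := by
  obtain ⟨A, hA, k, k1, k2, hk, -⟩ := exists_cutoffs
  have hBc : Continuous B := continuous_iff_continuousAt.2 fun y => (hd y).continuousAt
  have key : ∀ n, ∫ y, k n y ^ 1 * G y ≤ (A * ∫ y, |B y|) / 2 ^ n := fun n => by
    have hv := (hk n).vanish
    have hc0 := (hk n).cont0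
    have hc1 := (hk n).cont1
    have i1 : Integrable fun y => k n y * b y :=
      integrable_of_vanish (c := 2 * 2 ^ n) (by fun_prop) fun y hy => by
        simp [(hv y hy).1]
    have i2 : Integrable fun y => k1 n y * B y :=
      integrable_of_vanish (c := 2 * 2 ^ n) (by fun_prop) fun y hy => by
        simp [(hv y hy).2.1]
    have h0 := integral_deriv_eq_zero_of_vanish (fun y => ((hk n).d0 y).mul (hd y))
      (by fun_prop) (c := 2 * 2 ^ n) (fun y hy => by simp [(hv y hy).1])
    rw [integral_add i2 i1] at h0
    have h1 : ∫ y, k n y ^ 1 * G y ≤ ∫ y, k n y * b y := by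
      refine integral_mono (integrable_cutoff_mul (hk n) 1 hG) i1 fun y => ?_
      simpa using mul_le_mul_of_nonneg_left (hle y) ((hk n).nonneg y)
    have h2 : -∫ y, k1 n y * B y ≤ ∫ y, A / 2 ^ n * |B y| := by
      rw [← integral_neg]
      refine integral_mono i2.neg (hB.abs.const_mul _) fun y => ?_
      refine (neg_le_abs _).trans ?_
      rw [abs_mul]
      exact mul_le_mul_of_nonneg_right ((hk n).abs1 y) (abs_nonneg _)
    rw [integral_const_mul] at h2
    calc _ ≤ _ := h1
      _ ≤ A / 2 ^ n * ∫ y, |B y| := by linarith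
      _ = _ := by ring
  have hlim := tendsto_integral_cutoff hk 1 hG
  exact le_of_tendsto_of_tendsto' hlim (tendsto_div_two_pow _) key

/-! ### The Euclidean logarithmic Sobolev inequality on the line -/

/-- The distribution function of a positive continuous probability density. -/
lemma exists_strictMono_cdf {g : ℝ → ℝ} (hg : Continuous g) (hpos : ∀ y, 0 < g y)
    (hi : Integrable g) (h1 : ∫ y, g y = 1) :
    ∃ G : ℝ → ℝ, (∀ y, HasDerivAt G (g y) y) ∧ StrictMono G ∧ range G = Ioo 0 1 := by
  set G : ℝ → ℝ := fun y => (∫ x in Iic 0, g x) + ∫ x in (0 : ℝ)..y, g x with hG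
  have hGI : ∀ y, G y = ∫ x in Iic y, g x := fun y => by
    have := intervalIntegral.integral_Iic_sub_Iic (a := 0) (b := y) hi.integrableOn hi.integrableOn
    simp only [hG]; linarith
  have hd : ∀ y, HasDerivAt G (g y) y := fun y =>
    (intervalIntegral.integral_hasDerivAt_right (hg.intervalIntegrable _ _)
      (hg.stronglyMeasurableAtFilter _ _) hg.continuousAt).const_add _
  have hmono : StrictMono G := strictMono_of_deriv_pos fun y => by
    rw [(hd y).deriv]; exact hpos y
  have hbot : Tendsto G atBot (𝓝 0) := by
    have hI : ∀ y, G y = 1 - ∫ x in Ioi y, g x := fun y => by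
      rw [hGI, ← h1, ← intervalIntegral.integral_Iic_add_Ioi hi.integrableOn hi.integrableOn]
      ring
    simp_rw [funext hI]
    have := ((aecover_Ioi tendsto_id).integral_tendsto_of_countably_generated hi).const_sub 1
    simpa [h1] using this
  have htop : Tendsto G atTop (𝓝 1) := by
    simp_rw [funext hGI]
    rw [← h1]
    exact (aecover_Iic tendsto_id).integral_tendsto_of_countably_generated hi
  have hc : Continuous G := continuous_iff_continuousAt.2 fun y => (hd y).continuousAt
  refine ⟨G, hd, hmono, Subset.antisymm ?_ ?_⟩
  · rintro _ ⟨y, rfl⟩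
    constructor
    · exact (hmono.monotone.le_of_tendsto hbot (y - 1)).trans_lt (hmono (by linarith))
    · exact (hmono (by linarith : y < y + 1)).trans_le (hmono.monotone.ge_of_tendsto htop (y + 1))
  · intro p hp
    obtain ⟨a, ha⟩ := (hbot.eventually (gt_mem_nhds hp.1)).exists
    obtain ⟨b, hb⟩ := (htop.eventually (lt_mem_nhds hp.2)).exists
    exact mem_range_of_exists_le_of_exists_ge hc ⟨a, ha.le⟩ ⟨b, hb.le⟩

/-- The increasing rearrangement of one positive density onto another. -/
lemma exists_monotone_transport {g h : ℝ → ℝ} (hg : Continuous g) (hgpos : ∀ y, 0 < g y)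
    (hgi : Integrable g) (hg1 : ∫ y, g y = 1) (hh : Continuous h) (hhpos : ∀ y, 0 < h y)
    (hhi : Integrable h) (hh1 : ∫ y, h y = 1) :
    ∃ S : ℝ → ℝ, (∀ y, HasDerivAt S (g y / h (S y)) y) ∧ Function.Injective S ∧
      range S = univ := by
  obtain ⟨G, hGd, hGm, hGr⟩ := exists_strictMono_cdf hg hgpos hgi hg1
  obtain ⟨F, hFd, hFm, hFr⟩ := exists_strictMono_cdf hh hhpos hhi hh1
  have hex : ∀ y, ∃ t, F t = G y := fun y => by
    have : G y ∈ range F := by rw [hFr, ← hGr]; exact mem_range_self y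
    exact this
  choose S hS using hex
  have hSm : StrictMono S := fun a b hab => hFm.lt_iff_lt.1 (by rw [hS, hS]; exact hGm hab)
  have hSs : Function.Surjective S := fun t => by
    have : F t ∈ range G := by rw [hGr, ← hFr]; exact mem_range_self t
    obtain ⟨y, hy⟩ := this
    exact ⟨y, hFm.injective (by rw [hS, hy])⟩
  have hSc : Continuous S := hSm.monotone.continuous_of_surjective hSs
  refine ⟨S, fun y => ?_, hSm.injective, hSs.range_eq⟩
  have hder := hFd (S y)
  rw [hasDerivAt_iff_tendsto_slope] at hder ⊢
  have hne := (hhpos (S y)).ne'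
  have hSt : Tendsto S (𝓝[≠] y) (𝓝[≠] (S y)) :=
    tendsto_nhdsWithin_iff.2 ⟨hSc.continuousAt.tendsto.mono_left nhdsWithin_le_nhds,
      eventually_nhdsWithin_of_forall fun z hz => hSm.injective.ne hz⟩
  have h1 := (hasDerivAt_iff_tendsto_slope.1 (hGd y)).div (hder.comp hSt) hne
  refine h1.congr' (eventually_nhdsWithin_of_forall fun z hz => ?_)
  have hz' : z - y ≠ 0 := sub_ne_zero.2 hz
  have hz2 : G z - G y ≠ 0 := sub_ne_zero.2 (hGm.injective.ne hz)
  have hz3 : S z - S y ≠ 0 := sub_ne_zero.2 (hSm.injective.ne hz)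
  simp only [Function.comp, Pi.div_apply, slope_def_field, hS]
  field_simp

lemma integral_exp_mul_le_of_fisher {f f1 : ℝ → ℝ} (hf : ∀ y, HasDerivAt f (f1 y) y)
    (hf1 : Continuous f1) (hi : Integrable fun y => Real.exp (f y))
    (h1 : ∫ y, Real.exp (f y) = 1)
    (hif : Integrable fun y => Real.exp (f y) * f y)
    (hiJ : Integrable fun y => Real.exp (f y) * f1 y ^ 2)
    (hJ : 0 < ∫ y, Real.exp (f y) * f1 y ^ 2) :
    ∫ y, Real.exp (f y) * f y ≤
      1 / 2 * Real.log ((∫ y, Real.exp (f y) * f1 y ^ 2) / (2 * Real.pi)) - 1 / 2 := by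
  set J := ∫ y, Real.exp (f y) * f1 y ^ 2 with hJdef
  set h : ℝ → ℝ := ProbabilityTheory.gaussianPDFReal 0 1 with hh
  have hfc : Continuous f := continuous_iff_continuousAt.2 fun y => (hf y).continuousAt
  have hform : ∀ t, h t = (Real.sqrt (2 * Real.pi))⁻¹ * Real.exp (-t ^ 2 / 2) := fun t => by
    simp [hh, ProbabilityTheory.gaussianPDFReal]
  have hhc : Continuous h := by
    rw [funext hform]; fun_prop
  have hhpos : ∀ t, 0 < h t := fun t =>
    ProbabilityTheory.gaussianPDFReal_pos 0 1 t one_ne_zero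
  have hlogh : ∀ t, Real.log (h t) = -(1 / 2 * Real.log (2 * Real.pi)) - t ^ 2 / 2 := fun t => by
    rw [hform, Real.log_mul (by positivity) (by positivity), Real.log_exp, Real.log_inv,
      Real.log_sqrt (by positivity)]
    ring
  obtain ⟨S, hSd, hSinj, hSr⟩ := exists_monotone_transport (g := fun y => Real.exp (f y))
    (by fun_prop) (fun y => Real.exp_pos _) hi h1 hhc hhpos
    (ProbabilityTheory.integrable_gaussianPDFReal 0 1)
    (ProbabilityTheory.integral_gaussianPDFReal_eq_one 0 one_ne_zero)
  have hSc : Continuous S := continuous_iff_continuousAt.2 fun y => (hSd y).continuousAt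
  have hSne : ∀ y, h (S y) ≠ 0 := fun y => (hhpos _).ne'
  have hS2 : Integrable fun y => Real.exp (f y) * S y ^ 2 := by
    have hg2 : Integrable fun t : ℝ => h t * t ^ 2 := by
      have := (integrable_rpow_mul_exp_neg_mul_sq (b := 1 / 2) (by norm_num)
        (s := 2) (by norm_num)).const_mul (Real.sqrt (2 * Real.pi))⁻¹
      refine this.congr (Eventually.of_forall fun t => ?_)
      simp only [hform, Real.rpow_two]
      rw [show -t ^ 2 / 2 = -(1 / 2) * t ^ 2 by ring]
      ring
    have := (integrableOn_image_iff_integrableOn_abs_deriv_smul (s := univ) MeasurableSet.univ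
      (fun y _ => (hSd y).hasDerivWithinAt) hSinj.injOn (fun t => h t * t ^ 2)).1
      (by rw [image_univ, hSr]; exact hg2.integrableOn)
    rw [integrableOn_univ] at this
    refine this.congr (Eventually.of_forall fun y => ?_)
    have := hSne y
    have hp : 0 < Real.exp (f y) / h (S y) := div_pos (Real.exp_pos _) (hhpos _)
    simp only [smul_eq_mul, abs_of_pos hp]
    field_simp
  have hB : Integrable fun y => Real.exp (f y) * S y := by
    refine (hi.add hS2).mono (by fun_prop) (Eventually.of_forall fun y => ?_)
    have he := Real.exp_pos (f y)
    simp only [Pi.add_apply, Real.norm_eq_abs]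
    rw [abs_mul, abs_of_pos he, abs_of_nonneg (a := _ + _) (by positivity)]
    have : |S y| ≤ 1 + S y ^ 2 := by
      rw [← sq_abs]; nlinarith [sq_nonneg (|S y| - 1), abs_nonneg (S y)]
    nlinarith
  set l := (Real.sqrt J)⁻¹ with hl
  have hlpos : 0 < l := by positivity
  have hl2 : l ^ 2 * J = 1 := by
    rw [hl, inv_pow, Real.sq_sqrt hJ.le]; exact inv_mul_cancel₀ hJ.ne'
  have hlogl : Real.log l = -(1 / 2 * Real.log J) := by
    rw [hl, Real.log_inv, Real.log_sqrt hJ.le]; ring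
  have hmain := integral_nonpos_of_le_deriv
    (G := fun y => Real.exp (f y) * f y +
      (1 / 2 * Real.log (2 * Real.pi) + 1 + Real.log l) * Real.exp (f y) -
        l ^ 2 / 2 * (Real.exp (f y) * f1 y ^ 2))
    (B := fun y => l * (Real.exp (f y) * S y))
    (b := fun y => l * (Real.exp (f y) * f1 y * S y +
      Real.exp (f y) * (Real.exp (f y) / h (S y))))
    ((hif.add (hi.const_mul _)).sub (hiJ.const_mul _)) (hB.const_mul _)
    (fun y => (((hf y).exp).mul (hSd y)).const_mul l)
    (by
      have : Continuous fun y => h (S y) := hhc.comp hSc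
      fun_prop (disch := exact hSne))
    (fun y => by
      have he := Real.exp_pos (f y)
      set D := Real.exp (f y) / h (S y) with hD
      have hDpos : 0 < D := div_pos he (hhpos _)
      have hfD : f y = -(1 / 2 * Real.log (2 * Real.pi)) - S y ^ 2 / 2 + Real.log D := by
        rw [hD, Real.log_div he.ne' (hSne y), Real.log_exp, hlogh]; ring
      have hlog : Real.log l + Real.log D ≤ l * D - 1 := by
        rw [← Real.log_mul hlpos.ne' hDpos.ne']
        exact Real.log_le_sub_one_of_pos (by positivity)
      have : f y + (1 / 2 * Real.log (2 * Real.pi) + 1 + Real.log l) - l ^ 2 / 2 * f1 y ^ 2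
          ≤ l * (f1 y * S y + D) := by
        nlinarith [sq_nonneg (l * f1 y + S y)]
      nlinarith [mul_le_mul_of_nonneg_left this he.le])
  have hisum : Integrable fun y => Real.exp (f y) * f y +
      (1 / 2 * Real.log (2 * Real.pi) + 1 + Real.log l) * Real.exp (f y) :=
    hif.add (hi.const_mul _)
  rw [integral_sub hisum (hiJ.const_mul _), integral_add hif (hi.const_mul _), integral_const_mul,
    integral_const_mul, h1, ← hJdef,
    hlogl] at hmain
  rw [Real.log_div hJ.ne' (by positivity)]
  linarith

/-! ### Estimates at a fixed time -/

/-- `f1`, `f2`, `f3` are the first three derivatives of the `C³` function `f`. -/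
structure IsDerivChain (f f1 f2 f3 : ℝ → ℝ) : Prop where
  d0 : ∀ y, HasDerivAt f (f1 y) y
  d1 : ∀ y, HasDerivAt f1 (f2 y) y
  d2 : ∀ y, HasDerivAt f2 (f3 y) y
  cont3 : Continuous f3

namespace IsDerivChain

variable {f f1 f2 f3 : ℝ → ℝ}

lemma cont0 (h : IsDerivChain f f1 f2 f3) : Continuous f :=
  continuous_iff_continuousAt.2 fun y => (h.d0 y).continuousAt

lemma cont1 (h : IsDerivChain f f1 f2 f3) : Continuous f1 :=
  continuous_iff_continuousAt.2 fun y => (h.d1 y).continuousAt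

lemma cont2 (h : IsDerivChain f f1 f2 f3) : Continuous f2 :=
  continuous_iff_continuousAt.2 fun y => (h.d2 y).continuousAt

end IsDerivChain

lemma sq_cutoff_error_le {A k k1 k2 p U W : ℝ} (hA : 1 ≤ A) (hk : 0 ≤ k) (hk' : k ≤ 1)
    (hk1 : |k1| ≤ A) (hk2 : |k2| ≤ A) :
    ((12 * k1 ^ 2 + 4 * k * k2) * p + 4 * k1 * (2 * U + W / 2)) ^ 2 ≤
      768 * A ^ 4 * p ^ 2 + 192 * A ^ 2 * (U ^ 2 + W ^ 2) := by
  have hk1s : k1 ^ 2 ≤ A ^ 2 := sq_le_sq' (abs_le.1 hk1).1 (abs_le.1 hk1).2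
  have hk2' : |k * k2| ≤ A := by
    rw [abs_mul, abs_of_nonneg hk]
    exact (mul_le_of_le_one_left (abs_nonneg _) hk').trans hk2
  obtain ⟨hkl, hku⟩ := abs_le.1 hk2'
  have hAA : A ≤ A ^ 2 := by nlinarith
  obtain ⟨b, hb⟩ : ∃ b, b = 12 * k1 ^ 2 + 4 * k * k2 := ⟨_, rfl⟩
  have hbb : |b| ≤ 16 * A ^ 2 := by
    rw [abs_le]; constructor <;> nlinarith [sq_nonneg k1]
  have hb2 : b ^ 2 ≤ (16 * A ^ 2) ^ 2 := sq_le_sq' (abs_le.1 hbb).1 (abs_le.1 hbb).2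
  have h3 : ∀ x y z : ℝ, (x + y + z) ^ 2 ≤ 3 * (x ^ 2 + y ^ 2 + z ^ 2) := fun x y z => by
    nlinarith [sq_nonneg (x - y), sq_nonneg (x - z), sq_nonneg (y - z)]
  have h := h3 (b * p) (8 * (k1 * U)) (2 * (k1 * W))
  have h4 := mul_le_mul_of_nonneg_right hb2 (sq_nonneg p)
  have h5 := mul_le_mul_of_nonneg_right hk1s (sq_nonneg U)
  have h6 := mul_le_mul_of_nonneg_right hk1s (sq_nonneg W)
  have h7 : 0 ≤ A ^ 2 * W ^ 2 := by positivity
  rw [← hb, show b * p + 4 * k1 * (2 * U + W / 2) = b * p + 8 * (k1 * U) + 2 * (k1 * W) by ring]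
  refine h.trans ?_
  linarith

lemma fisher_dissipation_aux {α β c A a κ k1 p y X U W B : ℝ} (hα : 0 < α) (hc : 0 ≤ c)
    (ha : α ≤ a) (ha' : a ≤ β) (hκ : 0 ≤ κ) (hκ' : κ ≤ 1) (hk1 : k1 ^ 2 ≤ A ^ 2)
    (hB : B ^ 2 ≤ 768 * A ^ 4 * p ^ 2 + 192 * A ^ 2 * (U ^ 2 + W ^ 2))
    {K μ1 μ2 : ℝ} (hK : K = 2 * β + c / 2) (hμ2 : μ2 = 384 * K * A ^ 2)
    (hμ1 : μ1 = 2 * (192 * K * A ^ 2 + 9 * μ2)) :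
    -(a * X ^ 2) - a * X * B + c * (y * κ) * B + c * (y * κ) * X + α / 2 * X ^ 2 -
      (768 * K * A ^ 4 + 4 * A ^ 2 * μ2 + 2 * A ^ 2 * μ1 + μ1 ^ 2 / α) * p ^ 2 -
      (2 * c ^ 2 / α + c / 2) * y ^ 2 ≤
    μ1 * (2 * k1 * p * U + p * X + U ^ 2) + μ2 * (2 * k1 * p * W + W ^ 2 + 3 * W * U) := by
  have ha0 : 0 < a := hα.trans_le ha
  have hK0 : 0 ≤ K := by rw [hK]; linarith
  have hμ20 : 0 ≤ μ2 := by rw [hμ2]; positivity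
  have hμ10 : 0 ≤ μ1 := by rw [hμ1]; positivity
  have hyk : (y * κ) ^ 2 ≤ y ^ 2 := by
    rw [mul_pow]
    exact mul_le_of_le_one_right (sq_nonneg y) (pow_le_one₀ hκ hκ')
  have hpk := mul_le_mul_of_nonneg_right hk1 (sq_nonneg p)
  have e1 : -(a * X * B) ≤ a / 8 * X ^ 2 + 2 * a * B ^ 2 := by
    linarith [mul_nonneg ha0.le (sq_nonneg (X + 4 * B)),
      show a * (X + 4 * B) ^ 2 = a * X ^ 2 + 8 * (a * X * B) + 16 * a * B ^ 2 by ring]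
  have e2 : c * (y * κ) * B ≤ c / 2 * y ^ 2 + c / 2 * B ^ 2 := by
    linarith [mul_nonneg hc (sq_nonneg (y * κ - B)), mul_le_mul_of_nonneg_left hyk hc,
      show c * (y * κ - B) ^ 2 = c * (y * κ) ^ 2 - 2 * (c * (y * κ) * B) + c * B ^ 2 by ring]
  have e3 : c * (y * κ) * X ≤ α / 8 * X ^ 2 + 2 * c ^ 2 / α * y ^ 2 := by
    have h : 0 ≤ (α * X - 4 * c * (y * κ)) ^ 2 / (8 * α) := by positivity
    have h' : (α * X - 4 * c * (y * κ)) ^ 2 / (8 * α) =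
        α / 8 * X ^ 2 - c * (y * κ) * X + 2 * c ^ 2 / α * (y * κ) ^ 2 := by
      field_simp; ring
    have h2 : 2 * c ^ 2 / α * (y * κ) ^ 2 ≤ 2 * c ^ 2 / α * y ^ 2 := by gcongr
    linarith
  have e4 : 2 * a * B ^ 2 + c / 2 * B ^ 2 ≤ K * B ^ 2 := by
    rw [hK]; linarith [mul_le_mul_of_nonneg_right ha' (sq_nonneg B)]
  have e5 := mul_le_mul_of_nonneg_left hB hK0
  have e6 : W ^ 2 / 2 - 9 * U ^ 2 - 4 * A ^ 2 * p ^ 2 ≤ 2 * k1 * p * W + W ^ 2 + 3 * W * U := by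
    linarith [sq_nonneg (W / 2 + 3 * U), sq_nonneg (W / 2 + 2 * k1 * p),
      show (W / 2 + 3 * U) ^ 2 = W ^ 2 / 4 + 3 * W * U + 9 * U ^ 2 by ring,
      show (W / 2 + 2 * k1 * p) ^ 2 = W ^ 2 / 4 + 2 * k1 * p * W + 4 * (k1 ^ 2 * p ^ 2) by ring]
  have e7 : U ^ 2 / 2 - 2 * A ^ 2 * p ^ 2 ≤ 2 * k1 * p * U + U ^ 2 := by
    linarith [sq_nonneg (U + 2 * k1 * p),
      show (U + 2 * k1 * p) ^ 2 = U ^ 2 + 4 * k1 * p * U + 4 * (k1 ^ 2 * p ^ 2) by ring]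
  have e8 : -(α / 4 * X ^ 2) - μ1 ^ 2 / α * p ^ 2 ≤ μ1 * (p * X) := by
    have h : 0 ≤ (α * X + 2 * μ1 * p) ^ 2 / (4 * α) := by positivity
    have h' : (α * X + 2 * μ1 * p) ^ 2 / (4 * α) =
        α / 4 * X ^ 2 + μ1 * (p * X) + μ1 ^ 2 / α * p ^ 2 := by
      field_simp; ring
    linarith
  have e9 := mul_le_mul_of_nonneg_left e6 hμ20
  have e10 := mul_le_mul_of_nonneg_left e7 hμ10
  have e11 : α * X ^ 2 ≤ a * X ^ 2 := by gcongr
  have e12 : K * (192 * A ^ 2 * (U ^ 2 + W ^ 2)) =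
      μ1 * (U ^ 2 / 2) + μ2 * (W ^ 2 / 2) - 9 * μ2 * U ^ 2 := by
    rw [hμ1, hμ2]; ring
  linarith

lemma fisher_dissipation_algebra {α β c A a k k1 k2 p q t y : ℝ} (hα : 0 < α) (hc : 0 ≤ c)
    (hA : 1 ≤ A) (ha : α ≤ a) (ha' : a ≤ β) (hk : 0 ≤ k) (hk' : k ≤ 1) (hk1 : |k1| ≤ A)
    (hk2 : |k2| ≤ A) {K μ1 μ2 : ℝ} (hK : K = 2 * β + c / 2) (hμ2 : μ2 = 384 * K * A ^ 2)
    (hμ1 : μ1 = 2 * (192 * K * A ^ 2 + 9 * μ2)) :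
    -((a * t - c * y) * ((12 * k ^ 2 * k1 ^ 2 + 4 * k ^ 3 * k2) * p +
        4 * k ^ 3 * k1 * (2 * q + p ^ 2 / 2) + k ^ 4 * t)) + α / 2 * (k ^ 4 * t ^ 2) -
      (768 * K * A ^ 4 + 4 * A ^ 2 * μ2 + 2 * A ^ 2 * μ1 + μ1 ^ 2 / α) * p ^ 2 -
      (2 * c ^ 2 / α + c / 2) * y ^ 2 ≤
    μ1 * (2 * k * k1 * p * q + k ^ 2 * p * t + k ^ 2 * q ^ 2) +
      μ2 * (2 * k * k1 * p ^ 3 + k ^ 2 * p ^ 4 + 3 * k ^ 2 * p ^ 2 * q) := by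
  have h := fisher_dissipation_aux (y := y) (X := k ^ 2 * t) hα hc ha ha' (sq_nonneg k)
    (pow_le_one₀ hk hk') (sq_le_sq' (abs_le.1 hk1).1 (abs_le.1 hk1).2)
    (sq_cutoff_error_le (p := p) (U := k * q) (W := k * p ^ 2) hA hk hk' hk1 hk2) hK hμ2 hμ1
  linear_combination h

/-- The localized Fisher information dissipates, up to controlled errors. Here `N` is the time
derivative of `f = ln v`, the flux being `v (a t - c y)` with `t = (f'' + f'²/2)'`. -/
lemma exists_fisher_dissipation_bound {α β c A : ℝ} (hα : 0 < α) (hβ : α ≤ β) (hc : 0 ≤ c)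
    (hA : 1 ≤ A) : ∃ C1 C2 : ℝ, 0 ≤ C1 ∧ 0 ≤ C2 ∧
    ∀ {f f1 f2 f3 N Ny k k1 k2 : ℝ → ℝ} {a r : ℝ}, IsDerivChain f f1 f2 f3 → IsCutoff A r k k1 k2 →
      1 ≤ r → α ≤ a → a ≤ β → (∀ y, HasDerivAt N (Ny y) y) → Continuous Ny →
      (∀ y, HasDerivAt (fun y => Real.exp (f y) * (a * (f3 y + f1 y * f2 y) - c * y))
        (-(Real.exp (f y) * N y)) y) →
      Integrable (fun y => Real.exp (f y) * f1 y ^ 2) →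
      Integrable (fun y => Real.exp (f y) * y ^ 2) →
      ∫ y, k y ^ 4 * (1 / 2 * N y * Real.exp (f y) * f1 y ^ 2 + Real.exp (f y) * f1 y * Ny y) ≤
        -(α / 2 * ∫ y, k y ^ 4 * (Real.exp (f y) * (f3 y + f1 y * f2 y) ^ 2)) +
        C1 * (∫ y, Real.exp (f y) * f1 y ^ 2) + C2 * ∫ y, Real.exp (f y) * y ^ 2 := by
  obtain ⟨K, hK⟩ : ∃ K, K = 2 * β + c / 2 := ⟨_, rfl⟩
  obtain ⟨μ2, hμ2⟩ : ∃ μ2, μ2 = 384 * K * A ^ 2 := ⟨_, rfl⟩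
  obtain ⟨μ1, hμ1⟩ : ∃ μ1, μ1 = 2 * (192 * K * A ^ 2 + 9 * μ2) := ⟨_, rfl⟩
  have hK0 : 0 ≤ K := by rw [hK]; linarith
  have hμ20 : 0 ≤ μ2 := by rw [hμ2]; positivity
  have hμ10 : 0 ≤ μ1 := by rw [hμ1]; positivity
  obtain ⟨C1, hC1⟩ : ∃ C1, C1 = 768 * K * A ^ 4 + 4 * A ^ 2 * μ2 + 2 * A ^ 2 * μ1 + μ1 ^ 2 / α :=
    ⟨_, rfl⟩
  obtain ⟨C2, hC2⟩ : ∃ C2, C2 = 2 * c ^ 2 / α + c / 2 := ⟨_, rfl⟩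
  refine ⟨C1, C2, by rw [hC1]; positivity, by rw [hC2]; positivity, ?_⟩
  intro f f1 f2 f3 N Ny k k1 k2 a r hf hk hr ha ha' hN hNy hflux hJ hm
  have cf := hf.cont0
  have cf1 := hf.cont1
  have cf2 := hf.cont2
  have cf3 := hf.cont3
  have ck := hk.cont0
  have ck1 := hk.cont1
  have ck2 := hk.cont2
  have cN : Continuous N := continuous_iff_continuousAt.2 fun y => (hN y).continuousAt
  have hAr : A / r ≤ A := div_le_self (by linarith) hr
  set G' : ℝ → ℝ := fun y =>
    k y ^ 4 * (1 / 2 * N y * Real.exp (f y) * f1 y ^ 2 + Real.exp (f y) * f1 y * Ny y) +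
    Real.exp (f y) * ((a * (f3 y + f1 y * f2 y) - c * y) *
      ((12 * k y ^ 2 * k1 y ^ 2 + 4 * k y ^ 3 * k2 y) * f1 y +
        4 * k y ^ 3 * k1 y * (2 * f2 y + f1 y ^ 2 / 2) + k y ^ 4 * (f3 y + f1 y * f2 y))) +
    Real.exp (f y) * (μ1 * (2 * k y * k1 y * f1 y * f2 y + k y ^ 2 * f1 y * (f3 y + f1 y * f2 y)
        + k y ^ 2 * f2 y ^ 2) +
      μ2 * (2 * k y * k1 y * f1 y ^ 3 + k y ^ 2 * f1 y ^ 4 + 3 * k y ^ 2 * f1 y ^ 2 * f2 y))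
    with hG'
  have hv := hk.vanish
  have h0 : ∫ y, G' y = 0 := by
    refine integral_deriv_eq_zero_of_vanish (c := 2 * r)
      (g := fun y => k y ^ 4 * (Real.exp (f y) * f1 y * N y) +
        (Real.exp (f y) * (a * (f3 y + f1 y * f2 y) - c * y)) *
          (4 * (k y ^ 3 * k1 y) * f1 y + k y ^ 4 * (f2 y + f1 y ^ 2 / 2)) +
        (μ1 * (k y ^ 2 * (Real.exp (f y) * f1 y * f2 y)) +
          μ2 * (k y ^ 2 * (Real.exp (f y) * f1 y ^ 3))))
      (fun y => ?_) (by rw [hG']; fun_prop) (fun y hy => by simp [(hv y hy).1])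
    have dk := hk.d0 y
    have dk1 := hk.d1 y
    have de := (hf.d0 y).exp
    have d1 := hf.d1 y
    have d2 := hf.d2 y
    have A1 := (dk.pow 4).mul ((de.mul d1).mul (hN y))
    have A2 := (hflux y).mul (((((dk.pow 3).mul dk1).const_mul 4).mul d1).add
      ((dk.pow 4).mul (d2.add ((d1.pow 2).div_const 2))))
    have A3 := ((dk.pow 2).mul ((de.mul d1).mul d2)).const_mul μ1
    have A4 := ((dk.pow 2).mul (de.mul (d1.pow 3))).const_mul μ2
    refine ((A1.add A2).add (A3.add A4)).congr_deriv ?_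
    simp only [hG', Pi.mul_apply, Pi.pow_apply, Pi.add_apply]
    push_cast
    ring
  have hle : ∀ y,
      k y ^ 4 * (1 / 2 * N y * Real.exp (f y) * f1 y ^ 2 + Real.exp (f y) * f1 y * Ny y) +
      α / 2 * (k y ^ 4 * (Real.exp (f y) * (f3 y + f1 y * f2 y) ^ 2)) -
      C1 * (Real.exp (f y) * f1 y ^ 2) - C2 * (Real.exp (f y) * y ^ 2) ≤ G' y := fun y => by
    have := mul_le_mul_of_nonneg_left (fisher_dissipation_algebra (p := f1 y) (q := f2 y)
      (t := f3 y + f1 y * f2 y) (y := y) hα hc hA ha ha'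
      (hk.nonneg y) (hk.le_one y) ((hk.abs1 y).trans hAr) ((hk.abs2 y).trans hAr) hK hμ2 hμ1)
      (Real.exp_pos (f y)).le
    rw [← hC1, ← hC2] at this
    simp only [hG']
    linarith
  have i1 : Integrable fun y => k y ^ 4 *
      (1 / 2 * N y * Real.exp (f y) * f1 y ^ 2 + Real.exp (f y) * f1 y * Ny y) :=
    integrable_of_vanish (c := 2 * r) (by fun_prop) fun y hy => by simp [(hv y hy).1]
  have i2 : Integrable fun y => α / 2 *
      (k y ^ 4 * (Real.exp (f y) * (f3 y + f1 y * f2 y) ^ 2)) :=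
    integrable_of_vanish (c := 2 * r) (by fun_prop) fun y hy => by simp [(hv y hy).1]
  have i3 : Integrable G' :=
    integrable_of_vanish (c := 2 * r) (by rw [hG']; fun_prop) fun y hy => by
      simp [hG', (hv y hy).1]
  have i12 : Integrable fun y => k y ^ 4 *
      (1 / 2 * N y * Real.exp (f y) * f1 y ^ 2 + Real.exp (f y) * f1 y * Ny y) +
      α / 2 * (k y ^ 4 * (Real.exp (f y) * (f3 y + f1 y * f2 y) ^ 2)) := i1.add i2
  have i123 : Integrable fun y => k y ^ 4 *
      (1 / 2 * N y * Real.exp (f y) * f1 y ^ 2 + Real.exp (f y) * f1 y * Ny y) +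
      α / 2 * (k y ^ 4 * (Real.exp (f y) * (f3 y + f1 y * f2 y) ^ 2)) -
      C1 * (Real.exp (f y) * f1 y ^ 2) := i12.sub (hJ.const_mul C1)
  have := integral_mono (i123.sub (hm.const_mul C2)) i3 hle
  rw [h0, integral_sub' i123 (hm.const_mul C2), integral_sub i12 (hJ.const_mul C1),
    integral_add i1 i2, integral_const_mul, integral_const_mul, integral_const_mul] at this
  linarith

lemma IsCutoff.one_sub_le {A r : ℝ} {k k1 k2 : ℝ → ℝ} (hk : IsCutoff A r k k1 k2) (hr : 1 ≤ r)
    (y : ℝ) : 1 - k y ≤ y ^ 2 / r := by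
  have hr0 : 0 < r := by linarith
  by_cases hy : |y| ≤ r
  · rw [hk.eq_one y hy]; simp only [sub_self]; positivity
  · rw [le_div_iff₀ hr0]
    have h1 := not_le.1 hy
    have h2 : r ≤ y ^ 2 := by rw [← sq_abs]; nlinarith
    nlinarith [hk.nonneg y]

lemma entropy_error_algebra {A r a β c ε k k1 f p t y : ℝ} (hr : 1 ≤ r)
    (ha : 0 < a) (ha' : a ≤ β) (hc : 0 ≤ c) (hε : 0 < ε) (hk : 0 ≤ k) (hk' : k ≤ 1)
    (hky : 1 - k ≤ y ^ 2 / r) (hk1 : |k1| ≤ A / r) :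
    |a * k * p * t + c * k + k1 * (f + 1) * a * t - c * y * k1 * f - (a * (p * t) + c)| ≤
      β * ε * t ^ 2 + β / (4 * ε) * (p ^ 2 - k * p ^ 2) +
        (A * β * (f ^ 2 + 1 + t ^ 2) + c * A * (y ^ 2 + f ^ 2) + c * y ^ 2) / r := by
  have hr0 : 0 < r := by linarith
  have hA : 0 ≤ A / r := (abs_nonneg _).trans hk1
  have h1 : |a * (1 - k) * (p * t)| ≤ β * ε * t ^ 2 + β / (4 * ε) * (p ^ 2 - k * p ^ 2) := by
    have e : |p * t| ≤ ε * t ^ 2 + p ^ 2 / (4 * ε) := by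
      have h : 0 ≤ (2 * ε * |t| - |p|) ^ 2 / (4 * ε) := by positivity
      have h' : (2 * ε * |t| - |p|) ^ 2 / (4 * ε) =
          ε * |t| ^ 2 - |p| * |t| + |p| ^ 2 / (4 * ε) := by field_simp; ring
      rw [h', sq_abs, sq_abs] at h
      rw [abs_mul]; linarith
    rw [abs_mul, abs_of_nonneg (mul_nonneg ha.le (sub_nonneg.2 hk'))]
    have h2 : 0 ≤ ε * t ^ 2 := by positivity
    calc a * (1 - k) * |p * t| ≤ β * (1 - k) * (ε * t ^ 2 + p ^ 2 / (4 * ε)) := by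
          have : 0 ≤ 1 - k := by linarith
          have : 0 ≤ β := by linarith
          gcongr
      _ = β * ((1 - k) * (ε * t ^ 2)) + β / (4 * ε) * (p ^ 2 - k * p ^ 2) := by ring
      _ ≤ β * (1 * (ε * t ^ 2)) + β / (4 * ε) * (p ^ 2 - k * p ^ 2) := by
        gcongr
        · linarith
        · linarith
      _ = _ := by ring
  have h2 : |c * (1 - k)| ≤ c * (y ^ 2 / r) := by
    rw [abs_of_nonneg (mul_nonneg hc (sub_nonneg.2 hk'))]; gcongr
  have h3 : |k1 * (a * ((f + 1) * t))| ≤ A / r * (β * (f ^ 2 + 1 + t ^ 2)) := by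
    have e : |(f + 1) * t| ≤ f ^ 2 + 1 + t ^ 2 := by
      rw [abs_le]; constructor <;> nlinarith [sq_nonneg (f + 1 + t), sq_nonneg (f + 1 - t),
        sq_nonneg (f - 1)]
    rw [abs_mul, abs_mul, abs_of_pos ha]
    gcongr
    exact ha.le.trans ha'
  have h4 : |c * (k1 * (y * f))| ≤ c * (A / r * (y ^ 2 + f ^ 2)) := by
    have e : |y * f| ≤ y ^ 2 + f ^ 2 := by
      rw [abs_le]; constructor <;> nlinarith [sq_nonneg (y + f), sq_nonneg (y - f)]
    rw [abs_mul, abs_mul, abs_of_nonneg hc]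
    gcongr
  rw [show a * k * p * t + c * k + k1 * (f + 1) * a * t - c * y * k1 * f - (a * (p * t) + c) =
    k1 * (a * ((f + 1) * t)) - a * (1 - k) * (p * t) - c * (1 - k) - c * (k1 * (y * f)) by ring]
  have h5 := abs_sub (k1 * (a * ((f + 1) * t)) - a * (1 - k) * (p * t) - c * (1 - k))
    (c * (k1 * (y * f)))
  have h6 := abs_sub (k1 * (a * ((f + 1) * t)) - a * (1 - k) * (p * t)) (c * (1 - k))
  have h7 := abs_sub (k1 * (a * ((f + 1) * t))) (a * (1 - k) * (p * t))
  rw [show (A * β * (f ^ 2 + 1 + t ^ 2) + c * A * (y ^ 2 + f ^ 2) + c * y ^ 2) / r =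
    A / r * (β * (f ^ 2 + 1 + t ^ 2)) + c * (A / r * (y ^ 2 + f ^ 2)) + c * (y ^ 2 / r) by ring]
  linarith

lemma abs_integral_cutoff_entropy_sub_le {A r a β c ε : ℝ} {f f1 f2 f3 N k k1 k2 : ℝ → ℝ}
    (hf : IsDerivChain f f1 f2 f3) (hk : IsCutoff A r k k1 k2) (hr : 1 ≤ r)
    (ha : 0 < a) (ha' : a ≤ β) (hc : 0 ≤ c) (hε : 0 < ε) (hN : Continuous N)
    (hflux : ∀ y, HasDerivAt (fun y => Real.exp (f y) * (a * (f3 y + f1 y * f2 y) - c * y))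
      (-(Real.exp (f y) * N y)) y)
    (hi : Integrable fun y => Real.exp (f y))
    (hif : Integrable fun y => Real.exp (f y) * f y ^ 2)
    (hJ : Integrable fun y => Real.exp (f y) * f1 y ^ 2)
    (hm : Integrable fun y => Real.exp (f y) * y ^ 2)
    (ht : Integrable fun y => Real.exp (f y) * (f3 y + f1 y * f2 y) ^ 2) :
    |(∫ y, k y * (Real.exp (f y) * N y * (f y + 1))) -
        (a * (∫ y, Real.exp (f y) * (f1 y * (f3 y + f1 y * f2 y))) + c * ∫ y, Real.exp (f y))| ≤
      β * ε * (∫ y, Real.exp (f y) * (f3 y + f1 y * f2 y) ^ 2) +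
      β / (4 * ε) * ((∫ y, Real.exp (f y) * f1 y ^ 2) - ∫ y, k y * (Real.exp (f y) * f1 y ^ 2)) +
      (A * β * ((∫ y, Real.exp (f y) * f y ^ 2) + (∫ y, Real.exp (f y)) +
        ∫ y, Real.exp (f y) * (f3 y + f1 y * f2 y) ^ 2) +
        c * A * ((∫ y, Real.exp (f y) * y ^ 2) + ∫ y, Real.exp (f y) * f y ^ 2) +
        c * ∫ y, Real.exp (f y) * y ^ 2) / r := by
  have cf := hf.cont0
  have cf1 := hf.cont1
  have cf2 := hf.cont2
  have cf3 := hf.cont3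
  have ck := hk.cont0
  have ck1 := hk.cont1
  have hv := hk.vanish
  set Q : ℝ → ℝ := fun y => Real.exp (f y) * (a * k y * f1 y * (f3 y + f1 y * f2 y) + c * k y +
    k1 y * (f y + 1) * a * (f3 y + f1 y * f2 y) - c * y * k1 y * f y) with hQ
  have i1 : Integrable fun y => k y * (Real.exp (f y) * N y * (f y + 1)) :=
    integrable_of_vanish (c := 2 * r) (by fun_prop) fun y hy => by simp [(hv y hy).1]
  have i2 : Integrable Q := integrable_of_vanish (c := 2 * r) (by rw [hQ]; fun_prop) fun y hy => by
    simp [hQ, (hv y hy).1, (hv y hy).2.1]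
  have i3 : Integrable fun y => k y * (Real.exp (f y) * f1 y ^ 2) :=
    integrable_of_vanish (c := 2 * r) (by fun_prop) fun y hy => by simp [(hv y hy).1]
  have i4 : Integrable fun y => Real.exp (f y) * (f1 y * (f3 y + f1 y * f2 y)) := by
    refine (hJ.add ht).mono' (by fun_prop) (Eventually.of_forall fun y => ?_)
    rw [Real.norm_eq_abs, abs_mul, abs_of_pos (Real.exp_pos _)]
    simp only [Pi.add_apply]
    rw [← mul_add]
    gcongr
    rw [abs_le]
    constructor <;> nlinarith [sq_nonneg (f1 y + (f3 y + f1 y * f2 y)),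
      sq_nonneg (f1 y - (f3 y + f1 y * f2 y))]
  have hibp : ∫ y, (Q y - k y * (Real.exp (f y) * N y * (f y + 1))) = 0 := by
    refine integral_deriv_eq_zero_of_vanish (c := 2 * r)
      (g := fun y => k y * (Real.exp (f y) * (a * (f3 y + f1 y * f2 y) - c * y)) * (f y + 1) +
        c * (y * (k y * Real.exp (f y)))) (fun y => ?_) (by rw [hQ]; fun_prop)
      (fun y hy => by simp [(hv y hy).1])
    have A1 := ((hk.d0 y).mul (hflux y)).mul ((hf.d0 y).add_const 1)
    have A2 := ((hasDerivAt_id y).mul ((hk.d0 y).mul (hf.d0 y).exp)).const_mul c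
    refine (A1.add A2).congr_deriv ?_
    simp only [hQ, Pi.mul_apply, id]
    ring
  rw [integral_sub i2 i1, sub_eq_zero] at hibp
  have i5 : Integrable fun y => a * (Real.exp (f y) * (f1 y * (f3 y + f1 y * f2 y))) +
      c * Real.exp (f y) := (i4.const_mul a).add (hi.const_mul c)
  rw [← hibp, ← integral_const_mul, ← integral_const_mul, ← integral_add (i4.const_mul a)
    (hi.const_mul c), ← integral_sub i2 i5]
  refine (abs_integral_le_integral_abs).trans ?_
  have j1 := ht.const_mul (β * ε)
  have j2 := (hJ.sub i3).const_mul (β / (4 * ε))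
  have j3 := ((hif.add hi).add ht).const_mul (A * β)
  have j4 := (hm.add hif).const_mul (c * A)
  have j5 := hm.const_mul c
  have j := (j1.add j2).add (((j3.add j4).add j5).div_const r)
  refine (integral_mono (i2.sub i5).abs j fun y => ?_).trans (le_of_eq ?_)
  · have := mul_le_mul_of_nonneg_left (entropy_error_algebra (f := f y) (p := f1 y)
      (t := f3 y + f1 y * f2 y) hr ha ha' hc hε (hk.nonneg y) (hk.le_one y)
      (hk.one_sub_le hr y) (hk.abs1 y)) (Real.exp_pos (f y)).le
    simp only [hQ, Pi.add_apply, Pi.sub_apply]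
    rw [← abs_of_pos (Real.exp_pos (f y)), ← abs_mul, abs_of_pos (Real.exp_pos (f y))] at this
    refine (le_of_eq ?_).trans (this.trans (le_of_eq ?_))
    · congr 1; ring
    · ring
  · rw [integral_add' (j1.add j2) (((j3.add j4).add j5).div_const r), integral_add' j1 j2,
      integral_div, integral_add' (j3.add j4) j5, integral_add' j3 j4]
    simp only [integral_const_mul]
    rw [integral_sub' hJ i3, integral_add' (hif.add hi) ht, integral_add' hm hif,
      integral_add' hif hi]

lemma exp_le_of_fisher {f f1 f2 f3 : ℝ → ℝ} (hf : IsDerivChain f f1 f2 f3)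
    (hi : Integrable fun y => Real.exp (f y)) (h1 : ∫ y, Real.exp (f y) = 1)
    (hJ : Integrable fun y => Real.exp (f y) * f1 y ^ 2)
    (hbot : Tendsto (fun y => Real.exp (f y)) atBot (𝓝 0)) (y : ℝ) :
    Real.exp (f y) ≤ (1 + ∫ y, Real.exp (f y) * f1 y ^ 2) / 2 := by
  have cf := hf.cont0
  have cf1 := hf.cont1
  have hs : Integrable fun y => (Real.exp (f y) + Real.exp (f y) * f1 y ^ 2) / 2 :=
    (hi.add hJ).div_const 2
  have hle : ∀ y, |Real.exp (f y) * f1 y| ≤ (Real.exp (f y) + Real.exp (f y) * f1 y ^ 2) / 2 :=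
    fun y => by
      rw [abs_mul, abs_of_pos (Real.exp_pos _), ← sq_abs (f1 y)]
      nlinarith [mul_nonneg (Real.exp_pos (f y)).le (sq_nonneg (|f1 y| - 1))]
  have hg : Integrable fun y => Real.exp (f y) * f1 y :=
    hs.mono' (by fun_prop) (Eventually.of_forall hle)
  have := integral_Iic_of_hasDerivAt_of_tendsto' (a := y) (fun x _ => (hf.d0 x).exp)
    hg.integrableOn hbot
  rw [sub_zero] at this
  rw [← this]
  calc ∫ x in Iic y, Real.exp (f x) * f1 x
      ≤ ∫ x in Iic y, (Real.exp (f x) + Real.exp (f x) * f1 x ^ 2) / 2 :=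
        integral_mono hg.integrableOn hs.integrableOn fun x => (le_abs_self _).trans (hle x)
    _ ≤ ∫ x, (Real.exp (f x) + Real.exp (f x) * f1 x ^ 2) / 2 :=
        setIntegral_le_integral hs (Eventually.of_forall fun x => (abs_nonneg _).trans (hle x))
    _ = _ := by rw [integral_div, integral_add hi hJ, h1]

lemma exp_mul_sq_le {S u y : ℝ} (hS : Real.exp u ≤ S) :
    Real.exp u * u ^ 2 ≤ Real.exp u * (S ^ 2 + y ^ 2) + 26 * (1 + y ^ 2)⁻¹ := by
  have he := Real.exp_pos u
  have hS' := Real.add_one_le_exp u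
  have hy : 0 ≤ 26 * (1 + y ^ 2)⁻¹ := by positivity
  by_cases hu : 0 ≤ u
  · have : u ^ 2 ≤ S ^ 2 + y ^ 2 := by nlinarith [sq_nonneg y]
    nlinarith [mul_le_mul_of_nonneg_left this he.le]
  by_cases huy : -|y| ≤ u
  · have : u ^ 2 ≤ S ^ 2 + y ^ 2 := by rw [← sq_abs y]; nlinarith [sq_nonneg S]
    nlinarith [mul_le_mul_of_nonneg_left this he.le]
  · push Not at hu huy
    have h2 := Real.pow_div_factorial_le_exp (-u) (by linarith) 2
    have h4 := Real.pow_div_factorial_le_exp (-u) (by linarith) 4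
    norm_num [Nat.factorial] at h2 h4
    have hyu : y ^ 2 ≤ u ^ 2 := by rw [← sq_abs y]; nlinarith [abs_nonneg y]
    have key : Real.exp u * u ^ 2 ≤ 26 * (1 + y ^ 2)⁻¹ := by
      rw [← div_eq_mul_inv, le_div_iff₀ (by positivity)]
      have h5 : u ^ 2 * (1 + y ^ 2) ≤ 26 * Real.exp (-u) := by nlinarith [sq_nonneg u]
      calc Real.exp u * u ^ 2 * (1 + y ^ 2) = Real.exp u * (u ^ 2 * (1 + y ^ 2)) := by ring
        _ ≤ Real.exp u * (26 * Real.exp (-u)) := by gcongr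
        _ = 26 := by rw [mul_left_comm, ← Real.exp_add]; simp
    have : 0 ≤ Real.exp u * (S ^ 2 + y ^ 2) := by positivity
    linarith

lemma integrable_exp_mul_sq {f : ℝ → ℝ} {S : ℝ} (cf : Continuous f)
    (hS : ∀ y, Real.exp (f y) ≤ S) (hi : Integrable fun y => Real.exp (f y))
    (hm : Integrable fun y => Real.exp (f y) * y ^ 2) :
    Integrable (fun y => Real.exp (f y) * f y ^ 2) ∧
    ∫ y, Real.exp (f y) * f y ^ 2 ≤
      S ^ 2 * (∫ y, Real.exp (f y)) + (∫ y, Real.exp (f y) * y ^ 2) + 26 * Real.pi := by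
  have i1 : Integrable fun y => Real.exp (f y) * (S ^ 2 + y ^ 2) := by
    simp_rw [mul_add]; exact (hi.mul_const _).add hm
  have i2 : Integrable fun y : ℝ => 26 * (1 + y ^ 2)⁻¹ := integrable_inv_one_add_sq.const_mul 26
  have i3 : Integrable fun y => Real.exp (f y) * f y ^ 2 :=
    (i1.add i2).mono' (by fun_prop) (Eventually.of_forall fun y => by
      rw [Real.norm_of_nonneg (by positivity)]; exact exp_mul_sq_le (hS y))
  refine ⟨i3, (integral_mono i3 (i1.add i2) fun y => exp_mul_sq_le (hS y)).trans (le_of_eq ?_)⟩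
  rw [integral_add' i1 i2, integral_const_mul, integral_univ_inv_one_add_sq]
  simp_rw [mul_add]
  rw [integral_add (hi.mul_const _) hm, integral_mul_const]
  ring

lemma integrable_exp_mul {f : ℝ → ℝ} (cf : Continuous f)
    (hi : Integrable fun y => Real.exp (f y))
    (hf2 : Integrable fun y => Real.exp (f y) * f y ^ 2) :
    Integrable fun y => Real.exp (f y) * f y := by
  refine (hi.add hf2).mono' (by fun_prop) (Eventually.of_forall fun y => ?_)
  rw [norm_mul, Real.norm_of_nonneg (Real.exp_pos _).le, Real.norm_eq_abs]
  simp only [Pi.add_apply]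
  rw [← sq_abs (f y)]
  nlinarith [mul_nonneg (Real.exp_pos (f y)).le (sq_nonneg (|f y| - 1)),
    mul_nonneg (Real.exp_pos (f y)).le (abs_nonneg (f y))]

lemma two_mul_cutoff_le {ε k k1 p q : ℝ} (hk1 : |k1| ≤ ε) :
    -(2 * k * k1 * p * q) ≤ ε * (k ^ 2 * q ^ 2 + p ^ 2) := by
  have h : |k1 * (2 * (k * q * p))| ≤ ε * (k ^ 2 * q ^ 2 + p ^ 2) := by
    have : |2 * (k * q * p)| ≤ k ^ 2 * q ^ 2 + p ^ 2 := by
      rw [abs_le]; constructor <;> nlinarith [sq_nonneg (k * q + p), sq_nonneg (k * q - p)]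
    rw [abs_mul]
    exact mul_le_mul hk1 this (abs_nonneg _) ((abs_nonneg _).trans hk1)
  have := (abs_le.1 h).1
  linarith

/-- Integrated Cauchy–Schwarz form of the entropy production bound. -/
lemma integral_flux_le {f f1 f2 f3 : ℝ → ℝ} (hf : IsDerivChain f f1 f2 f3)
    (hi : Integrable fun y => Real.exp (f y)) (h1 : ∫ y, Real.exp (f y) = 1)
    (hJ : Integrable fun y => Real.exp (f y) * f1 y ^ 2)
    (ht : Integrable fun y => Real.exp (f y) * (f1 y * (f3 y + f1 y * f2 y))) :
    ∫ y, Real.exp (f y) * (f1 y * (f3 y + f1 y * f2 y)) ≤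
      -(∫ y, Real.exp (f y) * f1 y ^ 2) ^ 2 := by
  obtain ⟨A, hA, k, k1, k2, hk, -⟩ := exists_cutoffs
  set J := ∫ y, Real.exp (f y) * f1 y ^ 2 with hJd
  have hJ0 : 0 ≤ J := integral_nonneg fun y => by positivity
  have cf := hf.cont0
  have cf1 := hf.cont1
  have cf2 := hf.cont2
  have cf3 := hf.cont3
  have key : ∀ n, A / 2 ^ n ≤ 1 →
      ∫ y, k n y ^ 2 * (Real.exp (f y) * (f1 y * (f3 y + f1 y * f2 y))) ≤
      A / 2 ^ n * J + (1 - A / 2 ^ n) * (J ^ 2 * (∫ y, k n y ^ 2 * Real.exp (f y)) +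
        2 * J * (A / 2 ^ n * (1 + J) - ∫ y, k n y ^ 2 * (Real.exp (f y) * f1 y ^ 2))) := by
    intro n hε
    set ε := A / 2 ^ n with hεd
    have hε0 : 0 ≤ ε := by positivity
    have hv := (hk n).vanish
    have ck := (hk n).cont0
    have ck1 := (hk n).cont1
    set κ := k n
    set κ1 := k1 n
    set G' : ℝ → ℝ := fun y => Real.exp (f y) * (2 * κ y * κ1 y * f1 y * f2 y +
      κ y ^ 2 * f2 y ^ 2 + κ y ^ 2 * (f1 y * (f3 y + f1 y * f2 y)) +
      (1 - ε) * (2 * J) * (2 * κ y * κ1 y * f1 y * 1 + κ y ^ 2 * (f1 y ^ 2 + f2 y))) with hG'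
    have hG0 : ∫ y, G' y = 0 := by
      refine integral_deriv_eq_zero_of_vanish (c := 2 * 2 ^ n)
        (g := fun y => κ y ^ 2 * (f1 y * (Real.exp (f y) * f2 y)) +
          (1 - ε) * (2 * J) * (κ y ^ 2 * (Real.exp (f y) * f1 y))) (fun y => ?_)
        (by rw [hG']; fun_prop) (fun y hy => by simp [(hv y hy).1])
      have dk := (hk n).d0 y
      have de := (hf.d0 y).exp
      have A1 := (dk.pow 2).mul ((hf.d1 y).mul (de.mul (hf.d2 y)))
      have A2 := ((dk.pow 2).mul (de.mul (hf.d1 y))).const_mul ((1 - ε) * (2 * J))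
      refine (A1.add A2).congr_deriv ?_
      simp only [hG', Pi.mul_apply, Pi.pow_apply, κ, κ1]
      push_cast
      ring
    have i0 : Integrable fun y => κ y ^ 2 * (Real.exp (f y) * (f1 y * (f3 y + f1 y * f2 y))) :=
      integrable_cutoff_mul (hk n) 2 ht
    have i1 : Integrable fun y => κ y ^ 2 * Real.exp (f y) := integrable_cutoff_mul (hk n) 2 hi
    have i2 : Integrable fun y => κ y ^ 2 * (Real.exp (f y) * f1 y ^ 2) :=
      integrable_cutoff_mul (hk n) 2 hJ
    have i3 : Integrable G' := integrable_of_vanish (c := 2 * 2 ^ n) (by rw [hG']; fun_prop)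
      fun y hy => by simp [hG', (hv y hy).1]
    have j1 := hJ.const_mul ε
    have j2 := i1.const_mul (J ^ 2)
    have j3 := (hi.add hJ).const_mul ε
    have j4 := (j3.sub i2).const_mul (2 * J)
    have j5 := (j2.add j4).const_mul (1 - ε)
    have hle := integral_mono i0 (i3.add (j1.add j5)) fun y => by
      have e1 := two_mul_cutoff_le (k := κ y) (p := f1 y) (q := f2 y) ((hk n).abs1 y)
      have e2 := two_mul_cutoff_le (k := κ y) (p := f1 y) (q := 1) ((hk n).abs1 y)
      have hκ : κ y ^ 2 ≤ 1 := pow_le_one₀ ((hk n).nonneg y) ((hk n).le_one y)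
      have e3 : ε * (κ y ^ 2 * 1 ^ 2 + f1 y ^ 2) ≤ ε * (1 + f1 y ^ 2) := by gcongr; linarith
      have e4 : 0 ≤ (1 - ε) * (κ y ^ 2 * (f2 y + J) ^ 2) :=
        mul_nonneg (sub_nonneg.2 hε) (by positivity)
      have e5 := mul_le_mul_of_nonneg_left (e2.trans e3)
        (mul_nonneg (sub_nonneg.2 hε) (mul_nonneg zero_le_two hJ0))
      simp only [Pi.add_apply, Pi.sub_apply, hG']
      have := Real.exp_pos (f y)
      have e6 : κ y ^ 2 * (f1 y * (f3 y + f1 y * f2 y)) ≤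
          (2 * κ y * κ1 y * f1 y * f2 y +
          κ y ^ 2 * f2 y ^ 2 + κ y ^ 2 * (f1 y * (f3 y + f1 y * f2 y)) +
          (1 - ε) * (2 * J) * (2 * κ y * κ1 y * f1 y * 1 + κ y ^ 2 * (f1 y ^ 2 + f2 y))) +
          (ε * f1 y ^ 2 + (1 - ε) * (J ^ 2 * κ y ^ 2 + 2 * J * (ε * (1 + f1 y ^ 2) -
            κ y ^ 2 * f1 y ^ 2))) := by
        linarith
      have e7 := mul_le_mul_of_nonneg_left e6 this.le
      linarith
    rw [integral_add' i3 (j1.add j5), hG0, integral_add' j1 j5, integral_const_mul,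
      integral_const_mul, integral_add' j2 j4, integral_const_mul, integral_const_mul,
      integral_sub' j3 i2, integral_const_mul, integral_add' hi hJ, h1] at hle
    linarith
  have t0 := tendsto_integral_cutoff hk 2 ht
  have t1 := tendsto_integral_cutoff hk 2 hi
  have t2 := tendsto_integral_cutoff hk 2 hJ
  have te := tendsto_div_two_pow A
  have hev : ∀ᶠ n : ℕ in atTop, A / 2 ^ n ≤ 1 := te.eventually_le_const one_pos
  refine (le_of_tendsto_of_tendsto t0 ((te.mul_const J).add ((te.const_sub 1).mul
    ((t1.const_mul (J ^ 2)).add (((te.mul_const (1 + J)).sub t2).const_mul (2 * J)))))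
    (hev.mono key)).trans (le_of_eq ?_)
  rw [h1, ← hJd]; ring

lemma IsCutoff.le_integral {A r : ℝ} {k k1 k2 : ℝ → ℝ} (hk : IsCutoff A r k k1 k2) (hr : 0 ≤ r) :
    r ≤ ∫ y, k y := by
  have hi : Integrable k := integrable_of_vanish hk.cont0 fun y hy => (hk.vanish y hy).1
  calc r ≤ ∫ y in Icc (-r) r, (1 : ℝ) := by
        simp only [integral_const, smul_eq_mul, mul_one, measureReal_restrict_apply_univ,
          Real.volume_real_Icc]
        exact le_max_of_le_left (by linarith)
    _ = ∫ y in Icc (-r) r, k y :=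
        setIntegral_congr_fun measurableSet_Icc fun y hy => (hk.eq_one y (abs_le.2 hy)).symm
    _ ≤ ∫ y, k y := setIntegral_le_integral hi (Eventually.of_forall hk.nonneg)

lemma eq_zero_of_abs_mul_integral_cutoff_le {A C x : ℝ} {k k1 k2 : ℕ → ℝ → ℝ}
    (hk : ∀ n, IsCutoff A (2 ^ n) (k n) (k1 n) (k2 n)) (h : ∀ n, |∫ y, k n y * x| ≤ C) :
    x = 0 := by
  have h1 : ∀ n : ℕ, |x| ≤ C / 2 ^ n := fun n => by
    have hn := (hk n).le_integral (by positivity)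
    have h2n : (0 : ℝ) < 2 ^ n := by positivity
    rw [le_div_iff₀ h2n]
    refine le_trans ?_ (h n)
    rw [integral_mul_const, abs_mul, abs_of_nonneg (h2n.le.trans hn), mul_comm]
    gcongr
  exact abs_eq_zero.1 (le_antisymm (ge_of_tendsto' (tendsto_div_two_pow C) h1) (abs_nonneg x))

/-- The flux of a density with positive, finite Fisher information is not constant. -/
lemma exists_flux_deriv_ne_zero {f f1 f2 f3 q : ℝ → ℝ} (hf : IsDerivChain f f1 f2 f3)
    (hq : ∀ y, HasDerivAt (fun y => Real.exp (f y) * (f3 y + f1 y * f2 y)) (q y) y)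
    (hi : Integrable fun y => Real.exp (f y))
    (hJ : Integrable fun y => Real.exp (f y) * f1 y ^ 2)
    (hJ0 : 0 < ∫ y, Real.exp (f y) * f1 y ^ 2) : ∃ y, q y ≠ 0 := by
  by_contra hcon
  push Not at hcon
  obtain ⟨A, hA, k, k1, k2, hk, -⟩ := exists_cutoffs
  set J := ∫ y, Real.exp (f y) * f1 y ^ 2 with hJd
  have cf := hf.cont0
  have cf1 := hf.cont1
  have cf2 := hf.cont2
  have cf3 := hf.cont3
  have hb : ∀ p x ε : ℝ, |x| ≤ ε → |x * p| ≤ ε * (1 + p ^ 2) := fun p x ε hx => by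
    rw [abs_mul]
    refine mul_le_mul hx ?_ (abs_nonneg _) ((abs_nonneg _).trans hx)
    rw [← sq_abs]; nlinarith [abs_nonneg p]
  have hAn : ∀ n : ℕ, A / 2 ^ n ≤ A := fun n =>
    div_le_self (by linarith) (one_le_pow₀ one_le_two)
  have ibp1 : ∀ n, ∫ y, k n y * (Real.exp (f y) * (f1 y ^ 2 + f2 y)) +
      Real.exp (f y) * (k1 n y * f1 y) = 0 := fun n => by
    have ck := (hk n).cont0
    have ck1 := (hk n).cont1
    refine integral_deriv_eq_zero_of_vanish (c := 2 * 2 ^ n)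
      (g := fun y => k n y * (Real.exp (f y) * f1 y)) (fun y => ?_)
      (by fun_prop) (fun y hy => by simp [((hk n).vanish y hy).1])
    refine (((hk n).d0 y).mul ((hf.d0 y).exp.mul (hf.d1 y))).congr_deriv ?_
    simp only [Pi.mul_apply]
    ring
  have ibp2 : ∀ n, ∫ y, k n y * (Real.exp (f y) * (f3 y + f1 y * f2 y)) -
      Real.exp (f y) * (k2 n y * f1 y + k1 n y * f1 y ^ 2) = 0 := fun n => by
    have ck := (hk n).cont0
    have ck1 := (hk n).cont1
    have ck2 := (hk n).cont2
    refine integral_deriv_eq_zero_of_vanish (c := 2 * 2 ^ n)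
      (g := fun y => k n y * (Real.exp (f y) * f2 y) - k1 n y * (Real.exp (f y) * f1 y))
      (fun y => ?_) (by fun_prop)
      (fun y hy => by simp [((hk n).vanish y hy).1, ((hk n).vanish y hy).2.1])
    have de := (hf.d0 y).exp
    refine ((((hk n).d0 y).mul (de.mul (hf.d2 y))).sub
      (((hk n).d1 y).mul (de.mul (hf.d1 y)))).congr_deriv ?_
    simp only [Pi.mul_apply]
    ring
  have hi1 : Integrable fun y => Real.exp (f y) * (1 + f1 y ^ 2) := by
    simp_rw [mul_add, mul_one]; exact hi.add hJ
  have m1 : ∀ n y, |Real.exp (f y) * (k1 n y * f1 y)| ≤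
      A / 2 ^ n * (Real.exp (f y) * (1 + f1 y ^ 2)) := fun n y => by
    rw [abs_mul, abs_of_pos (Real.exp_pos _), mul_left_comm]
    gcongr
    exact hb _ _ _ ((hk n).abs1 y)
  have j1 : ∀ n, Integrable fun y => Real.exp (f y) * (k1 n y * f1 y) := fun n => by
    have ck1 := (hk n).cont1
    exact (hi1.const_mul _).mono' (by fun_prop) (Eventually.of_forall (m1 n))
  have n1 : ∀ n, |∫ y, Real.exp (f y) * (k1 n y * f1 y)| ≤
      (A * ∫ y, Real.exp (f y) * (1 + f1 y ^ 2)) / 2 ^ n := fun n => by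
    refine abs_integral_le_integral_abs.trans ((integral_mono (j1 n).abs
      (hi1.const_mul (A / 2 ^ n)) (m1 n)).trans (le_of_eq ?_))
    rw [integral_const_mul]; ring
  have hflux : ∀ y, Real.exp (f y) * (f3 y + f1 y * f2 y) = 0 := by
    have hc : ∀ y, Real.exp (f y) * (f3 y + f1 y * f2 y) =
        Real.exp (f 0) * (f3 0 + f1 0 * f2 0) := fun y =>
      is_const_of_deriv_eq_zero (fun z => (hq z).differentiableAt)
        (fun z => (hq z).deriv.trans (hcon z)) y 0
    have : Real.exp (f 0) * (f3 0 + f1 0 * f2 0) = 0 := by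
      refine eq_zero_of_abs_mul_integral_cutoff_le hk
        (C := 2 * A * ∫ y, Real.exp (f y) * (1 + f1 y ^ 2)) fun n => ?_
      have ck := (hk n).cont0
      have ck1 := (hk n).cont1
      have ck2 := (hk n).cont2
      have m : ∀ y, |Real.exp (f y) * (k2 n y * f1 y + k1 n y * f1 y ^ 2)| ≤
          2 * A * (Real.exp (f y) * (1 + f1 y ^ 2)) := fun y => by
        rw [abs_mul, abs_of_pos (Real.exp_pos _), mul_left_comm]
        gcongr
        have a1 := hb (f1 y) _ _ (((hk n).abs2 y).trans (hAn n))
        have a2 : |k1 n y * f1 y ^ 2| ≤ A * (1 + f1 y ^ 2) := by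
          rw [abs_mul, abs_of_nonneg (sq_nonneg (f1 y))]
          exact mul_le_mul (((hk n).abs1 y).trans (hAn n)) (by linarith) (sq_nonneg _)
            (by linarith)
        linarith [abs_add_le (k2 n y * f1 y) (k1 n y * f1 y ^ 2)]
      have j : Integrable fun y => Real.exp (f y) * (k2 n y * f1 y + k1 n y * f1 y ^ 2) :=
        (hi1.const_mul _).mono' (by fun_prop) (Eventually.of_forall m)
      have i : Integrable fun y => k n y * (Real.exp (f y) * (f3 y + f1 y * f2 y)) :=
        integrable_of_vanish (c := 2 * 2 ^ n) (by fun_prop) fun y hy => by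
          simp [((hk n).vanish y hy).1]
      have := ibp2 n
      rw [integral_sub i j, sub_eq_zero] at this
      simp_rw [hc] at this
      rw [this]
      refine abs_integral_le_integral_abs.trans ((integral_mono j.abs
        (hi1.const_mul (2 * A)) m).trans (le_of_eq ?_))
      rw [integral_const_mul]
    exact fun y => (hc y).trans this
  have hf2 : ∀ y, Real.exp (f y) * f2 y = 0 := by
    have hc : ∀ y, Real.exp (f y) * f2 y = Real.exp (f 0) * f2 0 := fun y => by
      have hd : ∀ z, HasDerivAt (fun z => Real.exp (f z) * f2 z) 0 z := fun z => by
        refine ((hf.d0 z).exp.mul (hf.d2 z)).congr_deriv ?_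
        rw [← hflux z]; ring
      exact is_const_of_deriv_eq_zero (fun z => (hd z).differentiableAt)
        (fun z => (hd z).deriv) y 0
    have : Real.exp (f 0) * f2 0 = 0 := by
      refine eq_zero_of_abs_mul_integral_cutoff_le hk
        (C := J + A * ∫ y, Real.exp (f y) * (1 + f1 y ^ 2)) fun n => ?_
      have ck := (hk n).cont0
      have i1 : Integrable fun y => k n y * (Real.exp (f y) * f1 y ^ 2) := by
        simpa using integrable_cutoff_mul (hk n) 1 hJ
      have i2 : Integrable fun y => k n y * (Real.exp (f y) * f2 y) :=
        integrable_of_vanish (c := 2 * 2 ^ n) (by fun_prop) fun y hy => by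
          simp [((hk n).vanish y hy).1]
      have e := ibp1 n
      simp_rw [mul_add] at e
      have i12 : Integrable fun y => k n y * (Real.exp (f y) * f1 y ^ 2) +
          k n y * (Real.exp (f y) * f2 y) := i1.add i2
      rw [integral_add i12 (j1 n), integral_add i1 i2] at e
      simp_rw [hc] at e
      have l1 : ∫ y, k n y * (Real.exp (f y) * f1 y ^ 2) ≤ J := integral_mono i1 hJ fun y =>
        mul_le_of_le_one_left (by positivity) ((hk n).le_one y)
      have l2 : 0 ≤ ∫ y, k n y * (Real.exp (f y) * f1 y ^ 2) := integral_nonneg fun y =>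
        mul_nonneg ((hk n).nonneg y) (by positivity)
      have l3 : (A * ∫ y, Real.exp (f y) * (1 + f1 y ^ 2)) / 2 ^ n ≤
          A * ∫ y, Real.exp (f y) * (1 + f1 y ^ 2) :=
        div_le_self (mul_nonneg (by linarith) (integral_nonneg fun y => by positivity))
          (one_le_pow₀ one_le_two)
      have := abs_le.1 ((n1 n).trans l3)
      rw [abs_le]; constructor <;> linarith [this.1, this.2]
    exact fun y => (hc y).trans this
  have hlim := tendsto_integral_cutoff hk 1 hJ
  have hzero : Tendsto (fun n => ∫ y, k n y ^ 1 * (Real.exp (f y) * f1 y ^ 2)) atTop (𝓝 0) := by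
    refine squeeze_zero_norm (fun n => ?_)
      (tendsto_div_two_pow (A * ∫ y, Real.exp (f y) * (1 + f1 y ^ 2)))
    refine le_trans (le_of_eq ?_) (n1 n)
    have e := ibp1 n
    simp_rw [mul_add, hf2, mul_zero, add_zero] at e
    have i1 : Integrable fun y => k n y * (Real.exp (f y) * f1 y ^ 2) := by
      simpa using integrable_cutoff_mul (hk n) 1 hJ
    rw [integral_add i1 (j1 n), add_eq_zero_iff_eq_neg] at e
    simp_rw [pow_one]
    rw [e, norm_neg, Real.norm_eq_abs]
  exact hJ0.ne' (tendsto_nhds_unique hlim hzero)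

/-! ### Calculus on the space-time slab -/

/-- The derivative in the first variable of a function on the plane. -/
noncomputable def spaceDeriv (g : ℝ × ℝ → ℝ) (p : ℝ × ℝ) : ℝ := fderiv ℝ g p (1, 0)

/-- The derivative in the second variable of a function on the plane. -/
noncomputable def timeDeriv (g : ℝ × ℝ → ℝ) (p : ℝ × ℝ) : ℝ := fderiv ℝ g p (0, 1)

/-- Smoothness on the slab `ℝ × (0, T)`. -/
def SmoothOnSlab (T : ℝ) (g : ℝ × ℝ → ℝ) : Prop :=
  ContDiffOn ℝ (⊤ : ℕ∞) g (univ ×ˢ Ioo 0 T)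

namespace SmoothOnSlab

variable {T : ℝ} {g : ℝ × ℝ → ℝ}

lemma slab_mem_nhds {y s : ℝ} (hs : s ∈ Ioo 0 T) : (univ : Set ℝ) ×ˢ Ioo 0 T ∈ 𝓝 (y, s) :=
  (isOpen_univ.prod isOpen_Ioo).mem_nhds ⟨mem_univ _, hs⟩

lemma contDiffAt (hg : SmoothOnSlab T g) {y s : ℝ} (hs : s ∈ Ioo 0 T) :
    ContDiffAt ℝ (⊤ : ℕ∞) g (y, s) :=
  ContDiffOn.contDiffAt hg (slab_mem_nhds hs)

lemma hasFDerivAt (hg : SmoothOnSlab T g) {y s : ℝ} (hs : s ∈ Ioo 0 T) :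
    HasFDerivAt g (fderiv ℝ g (y, s)) (y, s) :=
  ((hg.contDiffAt hs).differentiableAt (by simp)).hasFDerivAt

lemma smooth_fderiv (hg : SmoothOnSlab T g) :
    ContDiffOn ℝ (⊤ : ℕ∞) (fderiv ℝ g) (univ ×ˢ Ioo 0 T) :=
  ((contDiffOn_infty_iff_fderiv_of_isOpen (isOpen_univ.prod isOpen_Ioo)).1 hg).2

protected lemma spaceDeriv (hg : SmoothOnSlab T g) : SmoothOnSlab T (spaceDeriv g) :=
  hg.smooth_fderiv.clm_apply contDiffOn_const

protected lemma timeDeriv (hg : SmoothOnSlab T g) : SmoothOnSlab T (timeDeriv g) :=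
  hg.smooth_fderiv.clm_apply contDiffOn_const

lemma hasDerivAt_space (hg : SmoothOnSlab T g) {s : ℝ} (hs : s ∈ Ioo 0 T) (y : ℝ) :
    HasDerivAt (fun y => g (y, s)) (_root_.spaceDeriv g (y, s)) y :=
  (hg.hasFDerivAt hs).comp_hasDerivAt y ((hasDerivAt_id y).prodMk (hasDerivAt_const y s))

lemma hasDerivAt_time (hg : SmoothOnSlab T g) {s : ℝ} (hs : s ∈ Ioo 0 T) (y : ℝ) :
    HasDerivAt (fun s => g (y, s)) (_root_.timeDeriv g (y, s)) s :=
  (hg.hasFDerivAt hs).comp_hasDerivAt s ((hasDerivAt_const s y).prodMk (hasDerivAt_id s))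

lemma contDiffAt_time (hg : SmoothOnSlab T g) {s : ℝ} (hs : s ∈ Ioo 0 T) (y : ℝ) :
    ContDiffAt ℝ (⊤ : ℕ∞) (fun s => g (y, s)) s :=
  (hg.contDiffAt hs).comp s (contDiffAt_const.prodMk contDiffAt_id)

lemma continuous_space (hg : SmoothOnSlab T g) {s : ℝ} (hs : s ∈ Ioo 0 T) :
    Continuous fun y => g (y, s) :=
  continuous_iff_continuousAt.2 fun y => (hg.hasDerivAt_space hs y).continuousAt

lemma timeDeriv_spaceDeriv (hg : SmoothOnSlab T g) {s : ℝ} (hs : s ∈ Ioo 0 T) (y : ℝ) :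
    _root_.timeDeriv (_root_.spaceDeriv g) (y, s) =
      _root_.spaceDeriv (_root_.timeDeriv g) (y, s) := by
  have hd : DifferentiableAt ℝ (fderiv ℝ g) (y, s) :=
    (hg.smooth_fderiv.contDiffAt (slab_mem_nhds hs)).differentiableAt (by simp)
  have h := (hg.contDiffAt (y := y) hs).isSymmSndFDerivAt
    (by rw [minSmoothness_of_isRCLikeNormedField]; exact WithTop.coe_le_coe.2 le_top)
  have e : ∀ w : ℝ × ℝ, fderiv ℝ (fun p => fderiv ℝ g p w) (y, s) =
      (fderiv ℝ (fderiv ℝ g) (y, s)).flip w := fun w => by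
    rw [fderiv_clm_apply hd (differentiableAt_const w)]
    simp
  unfold _root_.timeDeriv _root_.spaceDeriv
  rw [e, e]
  exact h _ _

/-- Differentiation under the integral sign against a compactly supported weight. -/
lemma hasDerivAt_integral (hg : SmoothOnSlab T g) {χ : ℝ → ℝ} {c : ℝ} (hχ : Continuous χ)
    (h0 : ∀ y, c < |y| → χ y = 0) {s : ℝ} (hs : s ∈ Ioo 0 T) :
    HasDerivAt (fun s => ∫ y, χ y * g (y, s)) (∫ y, χ y * _root_.timeDeriv g (y, s)) s := by
  obtain ⟨δ, hδ, hball⟩ := Metric.nhds_basis_closedBall.mem_iff.1 (isOpen_Ioo.mem_nhds hs)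
  obtain ⟨M, hM⟩ := ((isCompact_Icc (a := -c) (b := c)).prod
    (isCompact_closedBall s δ)).exists_bound_of_continuousOn
    (hg.timeDeriv.continuousOn.mono (prod_mono (subset_univ _) hball))
  have hsub : Metric.ball s δ ⊆ Ioo 0 T := Metric.ball_subset_closedBall.trans hball
  refine (hasDerivAt_integral_of_dominated_loc_of_deriv_le (bound := fun y => |χ y| * M)
    (F' := fun s y => χ y * _root_.timeDeriv g (y, s)) (Metric.ball_mem_nhds s hδ) ?_ ?_ ?_ ?_ ?_
    ?_).2
  · filter_upwards [isOpen_Ioo.mem_nhds hs] with x hx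
    exact (hχ.mul (hg.continuous_space hx)).aestronglyMeasurable
  · exact integrable_of_vanish (c := c) (hχ.mul (hg.continuous_space hs)) fun y hy => by
      simp [h0 y hy]
  · exact (hχ.mul (hg.timeDeriv.continuous_space hs)).aestronglyMeasurable
  · refine Eventually.of_forall fun y x hx => ?_
    rw [norm_mul, Real.norm_eq_abs]
    by_cases hy : |y| ≤ c
    · gcongr
      exact hM (y, x) ⟨abs_le.1 hy, Metric.ball_subset_closedBall hx⟩
    · simp [h0 y (not_le.1 hy)]
  · exact integrable_of_vanish (c := c) (hχ.abs.mul continuous_const) fun y hy => by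
      simp [h0 y hy]
  · exact Eventually.of_forall fun y x hx =>
      ((hg.hasDerivAt_time (hsub hx) y)).const_mul (χ y)

end SmoothOnSlab

lemma integrable_of_integral_cutoff_le {A M : ℝ} {k k1 k2 : ℕ → ℝ → ℝ}
    (hk : ∀ n, IsCutoff A (2 ^ n) (k n) (k1 n) (k2 n)) {m : ℕ} (hm : m ≠ 0)
    {g : ℝ → ℝ} (cg : Continuous g)
    (hg : ∀ y, 0 ≤ g y) (hM : ∀ n, ∫ y, k n y ^ m * g y ≤ M) :
    Integrable g ∧ ∫ y, g y ≤ M := by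
  have ht : Tendsto (fun n : ℕ => (2 : ℝ) ^ n) atTop atTop :=
    tendsto_pow_atTop_atTop_of_one_lt (by norm_num)
  have hi : Integrable g := by
    refine (aecover_Icc (tendsto_neg_atTop_atBot.comp ht)
      ht).integrable_of_integral_bounded_of_nonneg_ae M
      (fun n => cg.integrableOn_Icc) (Eventually.of_forall hg) (Eventually.of_forall fun n => ?_)
    have ck := (hk n).cont0
    have hn : ∀ y, 0 ≤ k n y ^ m * g y := fun y =>
      mul_nonneg (pow_nonneg ((hk n).nonneg y) m) (hg y)
    have i : Integrable fun y => k n y ^ m * g y :=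
      integrable_of_vanish (c := 2 * 2 ^ n) (by fun_prop) fun y hy => by
        simp [((hk n).vanish y hy).1, hm]
    calc ∫ y in Icc (-(2 : ℝ) ^ n) (2 ^ n), g y
        = ∫ y in Icc (-(2 : ℝ) ^ n) (2 ^ n), k n y ^ m * g y :=
          setIntegral_congr_fun measurableSet_Icc fun y hy => by
            simp [(hk n).eq_one y (abs_le.2 hy)]
      _ ≤ ∫ y, k n y ^ m * g y := setIntegral_le_integral i (Eventually.of_forall hn)
      _ ≤ M := hM n
  exact ⟨hi, le_of_tendsto' (tendsto_integral_cutoff hk m hi) hM⟩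

/-- A one-sided bound on the derivatives of an approximating sequence passes to the limit. -/
lemma deriv_le_of_tendsto {F F' : ℕ → ℝ → ℝ} {G g : ℝ → ℝ} {G' s : ℝ} {S : Set ℝ}
    (hS : S ∈ 𝓝 s) (hF : ∀ n, ∀ x ∈ S, HasDerivAt (F n) (F' n x) x)
    (hle : ∀ᶠ n in atTop, ∀ x ∈ S, F' n x ≤ g x) (hg : ContinuousAt g s)
    (hlim : ∀ x ∈ S, Tendsto (fun n => F n x) atTop (𝓝 (G x))) (hG : HasDerivAt G G' s) :
    G' ≤ g s := by
  refine le_of_forall_pos_le_add fun ε hε => ?_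
  have hev : ∀ᶠ x in 𝓝 s, g x ≤ g s + ε := hg.eventually_le_const (by linarith)
  obtain ⟨δ, hδ, hball⟩ := Metric.mem_nhds_iff.1 (inter_mem hS hev)
  have key : ∀ x ∈ Ioo s (s + δ), slope G s x ≤ g s + ε := fun x hx => by
    have hsub : Icc s x ⊆ Metric.ball s δ := fun z hz => by
      rw [Metric.mem_ball, Real.dist_eq, abs_lt]; constructor <;> linarith [hz.1, hz.2, hx.2]
    have h1 : G x - G s ≤ (g s + ε) * (x - s) := by
      have h2 := ((hlim x (hball (hsub (right_mem_Icc.2 hx.1.le))).1).sub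
        (hlim s (hball (hsub (left_mem_Icc.2 hx.1.le))).1))
      refine le_of_tendsto h2 (hle.mono fun n hn => ?_)
      have hd : ∀ z ∈ Icc s x, HasDerivAt (F n) (F' n z) z := fun z hz =>
        hF n z (hball (hsub hz)).1
      refine (convex_Icc s x).image_sub_le_mul_sub_of_deriv_le
        (fun z hz => (hd z hz).continuousAt.continuousWithinAt)
        (fun z hz => (hd z (interior_subset hz)).differentiableAt.differentiableWithinAt)
        (fun z hz => ?_) s (left_mem_Icc.2 hx.1.le) x (right_mem_Icc.2 hx.1.le) hx.1.le
      have hz := interior_subset hz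
      rw [(hd z hz).deriv]
      exact (hn z (hball (hsub hz)).1).trans (hball (hsub hz)).2
    rw [slope_def_field, div_le_iff₀ (sub_pos.2 hx.1)]
    exact h1
  have hs : Tendsto (slope G s) (𝓝[>] s) (𝓝 G') := (hasDerivAt_iff_tendsto_slope.1 hG).mono_left
    (nhdsWithin_mono s fun x hx => ne_of_gt hx)
  exact le_of_tendsto hs (mem_of_superset (Ioo_mem_nhdsGT (by linarith)) key)

namespace SmoothOnSlab

variable {T : ℝ} {g h : ℝ × ℝ → ℝ}

protected lemma mul (hg : SmoothOnSlab T g) (hh : SmoothOnSlab T h) :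
    SmoothOnSlab T fun p => g p * h p := ContDiffOn.mul hg hh

protected lemma add (hg : SmoothOnSlab T g) (hh : SmoothOnSlab T h) :
    SmoothOnSlab T fun p => g p + h p := ContDiffOn.add hg hh

protected lemma exp (hg : SmoothOnSlab T g) : SmoothOnSlab T fun p => Real.exp (g p) :=
  ContDiffOn.exp hg

protected lemma pow (hg : SmoothOnSlab T g) (n : ℕ) : SmoothOnSlab T fun p => g p ^ n :=
  ContDiffOn.pow hg n

end SmoothOnSlab

/-- The quantity `(L_yy + L_y² / 2)_y`, so that `v (L_yy + L_y² / 2)_y = (v L_yy)_y` for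
`v = exp L`. -/
noncomputable def bohmForce (L : ℝ × ℝ → ℝ) (p : ℝ × ℝ) : ℝ :=
  spaceDeriv (spaceDeriv (spaceDeriv L)) p + spaceDeriv L p * spaceDeriv (spaceDeriv L) p

/-- Twice the Fisher information of the density `exp (L (·, s))`. -/
noncomputable def fisherIntegral (L : ℝ × ℝ → ℝ) (s : ℝ) : ℝ :=
  ∫ y, Real.exp (L (y, s)) * spaceDeriv L (y, s) ^ 2

/-- `L` is the logarithm of a smooth positive solution of the nonlocal rescaled DLSS equation with
confinement coefficient `c`, unit mass and second moment `θ`. -/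
structure IsLogSolution (c θ T : ℝ) (L : ℝ × ℝ → ℝ) : Prop where
  smooth : SmoothOnSlab T L
  flux : ∀ s ∈ Ioo 0 T, ∀ y,
    HasDerivAt (fun y => Real.exp (L (y, s)) *
      (2 / fisherIntegral L s * bohmForce L (y, s) - c * y))
      (-(Real.exp (L (y, s)) * timeDeriv L (y, s))) y
  integrable : ∀ s ∈ Ioo 0 T, Integrable fun y => Real.exp (L (y, s))
  mass : ∀ s ∈ Ioo 0 T, ∫ y, Real.exp (L (y, s)) = 1
  tendsto : ∀ s ∈ Ioo 0 T, Tendsto (fun y => Real.exp (L (y, s))) atBot (𝓝 0)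
  integrable_fisher : ∀ s ∈ Ioo 0 T,
    Integrable fun y => Real.exp (L (y, s)) * spaceDeriv L (y, s) ^ 2
  fisher_pos : ∀ s ∈ Ioo 0 T, 0 < fisherIntegral L s
  integrable_moment : ∀ s ∈ Ioo 0 T, Integrable fun y => Real.exp (L (y, s)) * y ^ 2
  moment : ∀ s ∈ Ioo 0 T, ∫ y, Real.exp (L (y, s)) * y ^ 2 = θ

namespace IsLogSolution

variable {c θ T : ℝ} {L : ℝ × ℝ → ℝ}

lemma chain (h : IsLogSolution c θ T L) {s : ℝ} (hs : s ∈ Ioo 0 T) :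
    IsDerivChain (fun y => L (y, s)) (fun y => spaceDeriv L (y, s))
      (fun y => spaceDeriv (spaceDeriv L) (y, s))
      (fun y => spaceDeriv (spaceDeriv (spaceDeriv L)) (y, s)) where
  d0 := h.smooth.hasDerivAt_space hs
  d1 := h.smooth.spaceDeriv.hasDerivAt_space hs
  d2 := h.smooth.spaceDeriv.spaceDeriv.hasDerivAt_space hs
  cont3 := h.smooth.spaceDeriv.spaceDeriv.spaceDeriv.continuous_space hs

lemma smooth_bohmForce (h : IsLogSolution c θ T L) : SmoothOnSlab T (bohmForce L) :=
  h.smooth.spaceDeriv.spaceDeriv.spaceDeriv.add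
    (h.smooth.spaceDeriv.mul h.smooth.spaceDeriv.spaceDeriv)

/-- Because the equation is nonlocal only through the Fisher information, the latter is a smooth
function of time. -/
lemma contDiffAt_fisherIntegral (h : IsLogSolution c θ T L) {τ : ℝ} (hτ : τ ∈ Ioo 0 T) :
    ContDiffAt ℝ 1 (fisherIntegral L) τ := by
  set P : ℝ × ℝ → ℝ := fun p => Real.exp (L p) * bohmForce L p with hP
  have sP : SmoothOnSlab T P := h.smooth.exp.mul h.smooth_bohmForce
  obtain ⟨y0, hy0⟩ := exists_flux_deriv_ne_zero (h.chain hτ) (sP.hasDerivAt_space hτ)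
    (h.integrable τ hτ) (h.integrable_fisher τ hτ) (h.fisher_pos τ hτ)
  set D : ℝ → ℝ := fun s => c * (Real.exp (L (y0, s)) * (1 + spaceDeriv L (y0, s) * y0)) -
    Real.exp (L (y0, s)) * timeDeriv L (y0, s) with hD
  have hrel : ∀ s ∈ Ioo 0 T, 2 / fisherIntegral L s * spaceDeriv P (y0, s) = D s := fun s hs => by
    have h1 := ((sP.hasDerivAt_space hs y0).const_mul (2 / fisherIntegral L s)).sub
      (((h.smooth.hasDerivAt_space hs y0).exp.mul (hasDerivAt_id y0)).const_mul c)
    have h2 := (h.flux s hs y0).unique (h1.congr_of_eventuallyEq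
      (Eventually.of_forall fun y => by simp [hP]; ring))
    simp only [hD, id] at h2 ⊢
    linear_combination -h2
  have cE := h.smooth.exp.contDiffAt_time hτ y0
  have cD : ContDiffAt ℝ 1 D τ := by
    refine ContDiffAt.of_le ?_ (m := (1 : WithTop ℕ∞)) (n := ((⊤ : ℕ∞) : WithTop ℕ∞))
      (WithTop.coe_le_coe.2 le_top)
    exact (contDiffAt_const.mul (cE.mul (contDiffAt_const.add
      ((h.smooth.spaceDeriv.contDiffAt_time hτ y0).mul contDiffAt_const)))).sub
      (cE.mul (h.smooth.timeDeriv.contDiffAt_time hτ y0))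
  have cP : ContDiffAt ℝ 1 (fun s => 2 * spaceDeriv P (y0, s)) τ := by
    refine ContDiffAt.of_le ?_ (m := (1 : WithTop ℕ∞)) (n := ((⊤ : ℕ∞) : WithTop ℕ∞))
      (WithTop.coe_le_coe.2 le_top)
    exact contDiffAt_const.mul (sP.spaceDeriv.contDiffAt_time hτ y0)
  have hD0 : D τ ≠ 0 := by
    rw [← hrel τ hτ]
    exact mul_ne_zero (div_ne_zero two_ne_zero (h.fisher_pos τ hτ).ne') hy0
  refine (cP.div cD hD0).congr_of_eventuallyEq ?_
  filter_upwards [isOpen_Ioo.mem_nhds hτ, cD.continuousAt.eventually_ne hD0] with s hs hs0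
  have := h.fisher_pos s hs
  rw [Pi.div_apply, eq_div_iff hs0, ← hrel s hs]
  field_simp

end IsLogSolution

lemma monotone_integral_cutoff {A : ℝ} {k k1 k2 : ℕ → ℝ → ℝ}
    (hk : ∀ n, IsCutoff A (2 ^ n) (k n) (k1 n) (k2 n)) (hmono : ∀ y, Monotone fun n => k n y)
    {m : ℕ} (hm : m ≠ 0) {g : ℝ → ℝ} (cg : Continuous g) (hg : ∀ y, 0 ≤ g y) :
    Monotone fun n => ∫ y, k n y ^ m * g y := by
  have i : ∀ n, Integrable fun y => k n y ^ m * g y := fun n =>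
    integrable_of_vanish (c := 2 * 2 ^ n) (((hk n).cont0.pow m).mul cg) fun y hy => by
      simp [((hk n).vanish y hy).1, hm]
  intro n n' hn
  refine integral_mono (i n) (i n') fun y => ?_
  exact mul_le_mul_of_nonneg_right (pow_le_pow_left₀ ((hk n).nonneg y) (hmono y hn) m) (hg y)

namespace IsLogSolution

variable {c θ T : ℝ} {L : ℝ × ℝ → ℝ}

lemma continuousAt_fisherIntegral (h : IsLogSolution c θ T L) {τ : ℝ} (hτ : τ ∈ Ioo 0 T) :
    ContinuousAt (fisherIntegral L) τ := (h.contDiffAt_fisherIntegral hτ).continuousAt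

lemma hasDerivAt_integral_cutoff_fisher (h : IsLogSolution c θ T L) {A r : ℝ}
    {k k1 k2 : ℝ → ℝ} (hk : IsCutoff A r k k1 k2) {s : ℝ} (hs : s ∈ Ioo 0 T) :
    HasDerivAt (fun s => ∫ y, k y ^ 4 * (Real.exp (L (y, s)) * spaceDeriv L (y, s) ^ 2))
      (2 * ∫ y, k y ^ 4 * (1 / 2 * timeDeriv L (y, s) * Real.exp (L (y, s)) *
        spaceDeriv L (y, s) ^ 2 + Real.exp (L (y, s)) * spaceDeriv L (y, s) *
        spaceDeriv (timeDeriv L) (y, s))) s := by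
  have sΦ : SmoothOnSlab T fun p => Real.exp (L p) * spaceDeriv L p ^ 2 :=
    h.smooth.exp.mul (h.smooth.spaceDeriv.pow 2)
  refine (sΦ.hasDerivAt_integral (χ := fun y => k y ^ 4) (hk.cont0.pow 4) (c := 2 * r)
    (fun y hy => by simp [(hk.vanish y hy).1]) hs).congr_deriv ?_
  rw [← integral_const_mul]
  refine integral_congr_ae (Eventually.of_forall fun y => ?_)
  have h1 := (h.smooth.hasDerivAt_time hs y).exp.mul
    ((h.smooth.spaceDeriv.hasDerivAt_time hs y).pow 2)
  have h2 := (sΦ.hasDerivAt_time hs y).unique h1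
  simp only [Pi.pow_apply] at h2
  simp only [h2, h.smooth.timeDeriv_spaceDeriv hs y]
  push_cast
  ring

/-- Locally uniformly in time, `∫ v ((L_yy + L_y² / 2)_y)²` is bounded. -/
lemma exists_dissipation_bound (h : IsLogSolution c θ T L) (hc : 0 ≤ c) {τ : ℝ}
    (hτ : τ ∈ Ioo 0 T) : ∃ δ > 0, Metric.ball τ δ ⊆ Ioo 0 T ∧ ∃ β R M : ℝ,
      ∀ s ∈ Metric.ball τ δ, 2 / fisherIntegral L s ≤ β ∧ fisherIntegral L s ≤ R ∧
        Integrable (fun y => Real.exp (L (y, s)) * bohmForce L (y, s) ^ 2) ∧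
        ∫ y, Real.exp (L (y, s)) * bohmForce L (y, s) ^ 2 ≤ M := by
  set J := fisherIntegral L
  have hJ0 : 0 < J τ := h.fisher_pos τ hτ
  have hcont : ContinuousAt J τ := h.continuousAt_fisherIntegral hτ
  obtain ⟨K, t, ht, hK⟩ := (h.contDiffAt_fisherIntegral hτ).exists_lipschitzOnWith
  obtain ⟨δ, hδ, hball⟩ := Metric.mem_nhds_iff.1 (inter_mem (inter_mem ht
    (isOpen_Ioo.mem_nhds hτ)) (inter_mem (hcont.eventually_const_le (half_lt_self hJ0))
    (hcont.eventually_le_const (show J τ < 2 * J τ by linarith))))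
  obtain ⟨A, hA, k, k1, k2, hk, hmono⟩ := exists_cutoffs
  have hα : 0 < 1 / J τ := by positivity
  obtain ⟨C1, C2, hC1, hC2, hdiss⟩ := exists_fisher_dissipation_bound hα
    (show 1 / J τ ≤ 4 / J τ by gcongr; norm_num) hc hA
  have hT : Metric.ball τ δ ⊆ Ioo 0 T := fun s hs => (hball hs).1.2
  set Q : ℝ := 2 * (C1 * (2 * J τ) + C2 * θ) with hQ
  set E : ℕ → ℝ → ℝ := fun n s => ∫ y, k n y ^ 4 *
    (Real.exp (L (y, s)) * bohmForce L (y, s) ^ 2) with hE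
  have sB : SmoothOnSlab T fun p => Real.exp (L p) * bohmForce L p ^ 2 :=
    h.smooth.exp.mul (h.smooth_bohmForce.pow 2)
  have hcE : ∀ n, ∀ s ∈ Ioo 0 T, ContinuousAt (E n) s := fun n s hs =>
    (sB.hasDerivAt_integral ((hk n).cont0.pow 4) (c := 2 * 2 ^ n)
      (fun y hy => by simp [((hk n).vanish y hy).1]) hs).continuousAt
  have hstep : ∀ n, ∀ s ∈ Metric.ball τ δ,
      2 * ∫ y, k n y ^ 4 * (1 / 2 * timeDeriv L (y, s) * Real.exp (L (y, s)) *
        spaceDeriv L (y, s) ^ 2 + Real.exp (L (y, s)) * spaceDeriv L (y, s) *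
        spaceDeriv (timeDeriv L) (y, s)) ≤ -(1 / J τ * E n s) + Q := fun n s hs => by
    have hsT := hT hs
    have hlo : J τ / 2 ≤ J s := (hball hs).2.1
    have hhi : J s ≤ 2 * J τ := (hball hs).2.2
    have hJs : 0 < J s := h.fisher_pos s hsT
    have := hdiss (h.chain hsT) (hk n) (one_le_pow₀ (by norm_num))
      (a := 2 / J s) (by rw [div_le_div_iff₀ hJ0 hJs]; linarith)
      (by rw [div_le_div_iff₀ hJs hJ0]; linarith) (h.smooth.timeDeriv.hasDerivAt_space hsT)
      (h.smooth.timeDeriv.spaceDeriv.continuous_space hsT) (h.flux s hsT)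
      (h.integrable_fisher s hsT) (h.integrable_moment s hsT)
    rw [h.moment s hsT] at this
    have h3 : C1 * (∫ y, Real.exp (L (y, s)) * spaceDeriv L (y, s) ^ 2) ≤ C1 * (2 * J τ) :=
      mul_le_mul_of_nonneg_left hhi hC1
    simp only [hE, hQ, bohmForce]
    linarith
  have hEm : ∀ s ∈ Metric.ball τ δ, ∀ m, E m s ≤ J τ * (K + Q) := fun s hs m => by
    have hsn : Metric.ball τ δ ∈ 𝓝 s := Metric.isOpen_ball.mem_nhds hs
    have hd : HasDerivAt J (deriv J s) s :=
      ((h.contDiffAt_fisherIntegral (hT hs)).differentiableAt (by simp)).hasDerivAt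
    have h1 := deriv_le_of_tendsto (g := fun s => -(1 / J τ * E m s) + Q) hsn
      (fun n x hx => h.hasDerivAt_integral_cutoff_fisher (hk n) (hT hx))
      ((eventually_ge_atTop m).mono fun n hn x hx => (hstep n x hx).trans ?_)
      (((hcE m s (hT hs)).const_mul _).neg.add continuousAt_const)
      (fun x hx => tendsto_integral_cutoff hk 4 (h.integrable_fisher x (hT hx))) hd
    · have h2 : ‖deriv J s‖ ≤ K := norm_deriv_le_of_lipschitzOn
        (mem_of_superset hsn fun x hx => (hball hx).1.1) hK
      have h3 := (abs_le.1 h2).1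
      have h4 : 1 / J τ * E m s ≤ K + Q := by linarith
      rwa [one_div, inv_mul_le_iff₀ hJ0] at h4
    · have : E m x ≤ E n x := monotone_integral_cutoff hk hmono four_ne_zero
        (sB.continuous_space (hT hx)) (fun y => by positivity) hn
      gcongr
  refine ⟨δ, hδ, hT, 4 / J τ, 2 * J τ, J τ * (K + Q), fun s hs => ⟨?_, (hball hs).2.2, ?_⟩⟩
  · have hlo : J τ / 2 ≤ J s := (hball hs).2.1
    rw [div_le_div_iff₀ (h.fisher_pos s (hT hs)) hJ0]; linarith
  · exact integrable_of_integral_cutoff_le hk four_ne_zero (sB.continuous_space (hT hs))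
      (fun y => by positivity) (hEm s hs)

end IsLogSolution

namespace IsLogSolution

variable {c θ T : ℝ} {L : ℝ × ℝ → ℝ}

lemma integrable_exp_mul_sq (h : IsLogSolution c θ T L) {s : ℝ} (hs : s ∈ Ioo 0 T) :
    Integrable (fun y => Real.exp (L (y, s)) * L (y, s) ^ 2) ∧
      ∫ y, Real.exp (L (y, s)) * L (y, s) ^ 2 ≤
        ((1 + fisherIntegral L s) / 2) ^ 2 + θ + 26 * Real.pi := by
  have := _root_.integrable_exp_mul_sq (h.chain hs).cont0 (exp_le_of_fisher (h.chain hs)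
    (h.integrable s hs) (h.mass s hs) (h.integrable_fisher s hs) (h.tendsto s hs))
    (h.integrable s hs) (h.integrable_moment s hs)
  rwa [h.mass s hs, mul_one, h.moment s hs] at this

lemma integrable_exp_mul (h : IsLogSolution c θ T L) {s : ℝ} (hs : s ∈ Ioo 0 T) :
    Integrable fun y => Real.exp (L (y, s)) * L (y, s) :=
  _root_.integrable_exp_mul (h.chain hs).cont0 (h.integrable s hs) (h.integrable_exp_mul_sq hs).1

lemma hasDerivAt_integral_cutoff_entropy (h : IsLogSolution c θ T L) {A r : ℝ}
    {k k1 k2 : ℝ → ℝ} (hk : IsCutoff A r k k1 k2) {s : ℝ} (hs : s ∈ Ioo 0 T) :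
    HasDerivAt (fun s => ∫ y, k y * (Real.exp (L (y, s)) * L (y, s)))
      (∫ y, k y * (Real.exp (L (y, s)) * timeDeriv L (y, s) * (L (y, s) + 1))) s := by
  have sΦ : SmoothOnSlab T fun p => Real.exp (L p) * L p := h.smooth.exp.mul h.smooth
  refine (sΦ.hasDerivAt_integral hk.cont0 (fun y hy => (hk.vanish y hy).1) hs).congr_deriv ?_
  refine integral_congr_ae (Eventually.of_forall fun y => ?_)
  have h1 := h.smooth.hasDerivAt_time hs y
  have h2 := (sΦ.hasDerivAt_time hs y).unique (h1.exp.mul h1)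
  simp only [h2]
  ring

lemma tendstoUniformlyOn_integral_cutoff_fisher (h : IsLogSolution c θ T L) {A : ℝ}
    {k k1 k2 : ℕ → ℝ → ℝ} (hk : ∀ n, IsCutoff A (2 ^ n) (k n) (k1 n) (k2 n))
    (hmono : ∀ y, Monotone fun n => k n y) {S : Set ℝ} (hS : IsCompact S) (hST : S ⊆ Ioo 0 T) :
    TendstoUniformlyOn
      (fun n s => ∫ y, k n y * (Real.exp (L (y, s)) * spaceDeriv L (y, s) ^ 2))
      (fisherIntegral L) atTop S := by
  have sΦ : SmoothOnSlab T fun p => Real.exp (L p) * spaceDeriv L p ^ 2 :=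
    h.smooth.exp.mul (h.smooth.spaceDeriv.pow 2)
  refine Monotone.tendstoUniformlyOn_of_forall_tendsto hS (fun n s hs => ?_) (fun s hs => ?_)
    (fun s hs => (h.continuousAt_fisherIntegral (hST hs)).continuousWithinAt) (fun s hs => ?_)
  · exact (sΦ.hasDerivAt_integral (hk n).cont0 (fun y hy => ((hk n).vanish y hy).1)
      (hST hs)).continuousAt.continuousWithinAt
  · simpa only [pow_one] using monotone_integral_cutoff hk hmono one_ne_zero
      (sΦ.continuous_space (hST hs)) (fun y => by positivity)
  · simpa only [pow_one, fisherIntegral] using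
      tendsto_integral_cutoff hk 1 (h.integrable_fisher s (hST hs))

lemma hasDerivAt_entropy (h : IsLogSolution c θ T L) (hc : 0 ≤ c) {τ : ℝ} (hτ : τ ∈ Ioo 0 T) :
    HasDerivAt (fun s => ∫ y, Real.exp (L (y, s)) * L (y, s))
      (2 / fisherIntegral L τ *
        (∫ y, Real.exp (L (y, τ)) * (spaceDeriv L (y, τ) * bohmForce L (y, τ))) + c) τ := by
  obtain ⟨δ, hδ, hT, β, R, M, hbd⟩ := h.exists_dissipation_bound hc hτ
  obtain ⟨A, hA, k, k1, k2, hk, hmono⟩ := exists_cutoffs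
  have hA0 : 0 ≤ A := by linarith
  set S := Metric.ball τ (δ / 2) with hS
  have hSδ : Metric.closedBall τ (δ / 2) ⊆ Metric.ball τ δ :=
    Metric.closedBall_subset_ball (half_lt_self hδ)
  have hSsub : S ⊆ Metric.ball τ δ := Metric.ball_subset_closedBall.trans hSδ
  have hτδ : τ ∈ Metric.ball τ δ := Metric.mem_ball_self hδ
  have hβ : 0 ≤ β := le_trans (by have := h.fisher_pos τ hτ; positivity) (hbd τ hτδ).1
  have hM : 0 ≤ M :=
    (integral_nonneg fun y => by positivity).trans (hbd τ hτδ).2.2.2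
  have huJ := (h.tendstoUniformlyOn_integral_cutoff_fisher hk hmono
    (isCompact_closedBall τ (δ / 2)) (hSδ.trans hT)).mono Metric.ball_subset_closedBall
  set W : ℝ := ((1 + R) / 2) ^ 2 + θ + 26 * Real.pi with hW
  set B : ℝ := A * β * (W + 1 + M) + c * A * (θ + W) + c * θ with hB
  refine hasDerivAt_of_tendstoUniformlyOn (l := atTop) (s := S) Metric.isOpen_ball
    (f' := fun n s => ∫ y, k n y *
      (Real.exp (L (y, s)) * timeDeriv L (y, s) * (L (y, s) + 1)))
    (g' := fun s => 2 / fisherIntegral L s *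
      (∫ y, Real.exp (L (y, s)) * (spaceDeriv L (y, s) * bohmForce L (y, s))) + c)
    (Metric.tendstoUniformlyOn_iff.2 fun η hη => ?_)
    (Eventually.of_forall fun n s hs => h.hasDerivAt_integral_cutoff_entropy (hk n)
      (hT (hSsub hs)))
    (fun s hs => by
      simpa only [pow_one] using
        tendsto_integral_cutoff hk 1 (h.integrable_exp_mul (hT (hSsub hs))))
    (Metric.mem_ball_self (half_pos hδ))
  set ε : ℝ := η / (4 * (β * M + 1)) with hε
  have hε0 : 0 < ε := by positivity
  have hεle : β * ε * M ≤ η / 4 := by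
    rw [hε, show β * (η / (4 * (β * M + 1))) * M = η / 4 * (β * M / (β * M + 1)) by field_simp]
    exact mul_le_of_le_one_right (by positivity) ((div_le_one (by positivity)).2 (by linarith))
  filter_upwards [Metric.tendstoUniformlyOn_iff.1 huJ (η / 4 / (β / (4 * ε) + 1)) (by positivity),
    (tendsto_div_two_pow B).eventually_le_const (show (0 : ℝ) < η / 4 by positivity)]
    with n hn hn2 s hs
  have hsT := hT (hSsub hs)
  obtain ⟨b1, b2, b3, b4⟩ := hbd s (hSsub hs)
  have hJs := h.fisher_pos s hsT
  obtain ⟨e1, e2⟩ := h.integrable_exp_mul_sq hsT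
  have e3 : ∫ y, Real.exp (L (y, s)) * L (y, s) ^ 2 ≤ W := e2.trans (by rw [hW]; gcongr)
  have key := abs_integral_cutoff_entropy_sub_le (h.chain hsT) (hk n)
    (one_le_pow₀ (by norm_num)) (show 0 < 2 / fisherIntegral L s by positivity) b1 hc hε0
    (h.smooth.timeDeriv.continuous_space hsT) (h.flux s hsT) (h.integrable s hsT) e1
    (h.integrable_fisher s hsT) (h.integrable_moment s hsT) b3
  rw [h.mass s hsT, h.moment s hsT, mul_one] at key
  rw [dist_comm, Real.dist_eq]
  refine lt_of_le_of_lt key ?_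
  have f1 : β * ε * (∫ y, Real.exp (L (y, s)) * bohmForce L (y, s) ^ 2) ≤ η / 4 :=
    (mul_le_mul_of_nonneg_left b4 (by positivity)).trans hεle
  have f2 : β / (4 * ε) * (fisherIntegral L s -
      ∫ y, k n y * (Real.exp (L (y, s)) * spaceDeriv L (y, s) ^ 2)) ≤ η / 4 := by
    have h1 := (le_abs_self _).trans (hn s hs).le
    have h2 : β / (4 * ε) ≤ β / (4 * ε) + 1 := by linarith
    calc _ ≤ β / (4 * ε) * (η / 4 / (β / (4 * ε) + 1)) :=
          mul_le_mul_of_nonneg_left h1 (by positivity)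
      _ ≤ (β / (4 * ε) + 1) * (η / 4 / (β / (4 * ε) + 1)) :=
          mul_le_mul_of_nonneg_right h2 (by positivity)
      _ = η / 4 := by field_simp
  have f3 : (A * β * ((∫ y, Real.exp (L (y, s)) * L (y, s) ^ 2) + 1 +
      ∫ y, Real.exp (L (y, s)) * bohmForce L (y, s) ^ 2) +
      c * A * (θ + ∫ y, Real.exp (L (y, s)) * L (y, s) ^ 2) + c * θ) / 2 ^ n ≤ η / 4 := by
    refine le_trans ?_ hn2
    rw [hB]
    gcongr
  have f4 := add_le_add f1 f2
  have f5 := add_le_add f4 f3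
  exact f5.trans_lt (by linarith)

/-- Along a solution the entropy production is controlled by the Fisher information. -/
lemma exists_hasDerivAt_entropy_le (h : IsLogSolution c θ T L) (hc : 0 ≤ c) {τ : ℝ}
    (hτ : τ ∈ Ioo 0 T) : ∃ D, HasDerivAt (fun s => ∫ y, Real.exp (L (y, s)) * L (y, s)) D τ ∧
      D ≤ -(2 * fisherIntegral L τ) + c := by
  refine ⟨_, h.hasDerivAt_entropy hc hτ, ?_⟩
  obtain ⟨δ, hδ, -, β, R, M, hbd⟩ := h.exists_dissipation_bound hc hτ
  obtain ⟨-, -, hB, -⟩ := hbd τ (Metric.mem_ball_self hδ)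
  have hJ := h.fisher_pos τ hτ
  have hi : Integrable fun y =>
      Real.exp (L (y, τ)) * (spaceDeriv L (y, τ) * bohmForce L (y, τ)) := by
    have c1 := h.smooth.continuous_space hτ
    have c2 := h.smooth.spaceDeriv.continuous_space hτ
    have c3 := h.smooth_bohmForce.continuous_space hτ
    refine ((h.integrable_fisher τ hτ).add hB).mono'
      (c1.rexp.mul (c2.mul c3)).aestronglyMeasurable (Eventually.of_forall fun y => ?_)
    rw [norm_mul, Real.norm_of_nonneg (Real.exp_pos _).le, Pi.add_apply, ← mul_add]
    refine mul_le_mul_of_nonneg_left ?_ (Real.exp_pos _).le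
    rw [Real.norm_eq_abs, abs_le]
    constructor <;> nlinarith [sq_nonneg (spaceDeriv L (y, τ) + bohmForce L (y, τ)),
      sq_nonneg (spaceDeriv L (y, τ) - bohmForce L (y, τ))]
  have h1 : (∫ y, Real.exp (L (y, τ)) * (spaceDeriv L (y, τ) * bohmForce L (y, τ))) ≤
      -(fisherIntegral L τ) ^ 2 :=
    integral_flux_le (h.chain hτ) (h.integrable τ hτ) (h.mass τ hτ) (h.integrable_fisher τ hτ) hi
  have h2 := mul_le_mul_of_nonneg_left h1 (show 0 ≤ 2 / fisherIntegral L τ by positivity)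
  have h3 : 2 / fisherIntegral L τ * -(fisherIntegral L τ) ^ 2 = -(2 * fisherIntegral L τ) := by
    field_simp
  linarith

lemma exp_two_mul_entropy_le (h : IsLogSolution c θ T L) (hθ : 0 < θ) {τ : ℝ}
    (hτ : τ ∈ Ioo 0 T) :
    Real.exp (2 * (1 / 2 * Real.log (2 * Real.pi * Real.exp 1 * θ) +
      ∫ y, Real.exp (L (y, τ)) * L (y, τ))) ≤ θ * fisherIntegral L τ := by
  have hJ := h.fisher_pos τ hτ
  have hlog := integral_exp_mul_le_of_fisher (h.chain hτ).d0 (h.chain hτ).cont1 (h.integrable τ hτ)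
    (h.mass τ hτ) (h.integrable_exp_mul hτ) (h.integrable_fisher τ hτ) hJ
  rw [← Real.le_log_iff_exp_le (by positivity)]
  have e1 : Real.log (2 * Real.pi * Real.exp 1 * θ) = Real.log (2 * Real.pi) + 1 + Real.log θ := by
    rw [Real.log_mul (by positivity) hθ.ne', Real.log_mul (by positivity) (Real.exp_pos 1).ne',
      Real.log_exp]
  have e2 : Real.log (fisherIntegral L τ / (2 * Real.pi)) =
      Real.log (fisherIntegral L τ) - Real.log (2 * Real.pi) :=
    Real.log_div hJ.ne' (by positivity)
  have e3 := Real.log_mul hθ.ne' hJ.ne'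
  change _ ≤ 1 / 2 * Real.log (fisherIntegral L τ / (2 * Real.pi)) - 1 / 2 at hlog
  linarith

end IsLogSolution

/-- the differential inequality for the relative Boltzmann entropy
along smooth positive solutions of the nonlocal rescaled DLSS equation:
`(d/dτ) H(v(·,τ)|B₁) ≤ −(2/Θ₀)(exp(2H(v(·,τ)|B₁)) − 1)`. -/
theorem dlss_relative_entropy_inequality
    (Θ₀ T : ℝ) (hΘ₀ : 0 < Θ₀) (hT : 0 < T)
    (v : ℝ → ℝ → ℝ)
    (hsmooth : ContDiffOn ℝ (⊤ : ℕ∞) (Function.uncurry v) (univ ×ˢ Ioo 0 T))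
    (hpos : ∀ y τ, τ ∈ Ioo 0 T → 0 < v y τ)
    (hpde : ∀ y τ, τ ∈ Ioo 0 T →
      deriv (fun s => v y s) τ =
        -(1 / fisher (fun z => v z τ)) *
            deriv (deriv (fun z =>
              v z τ * deriv (deriv (fun w => Real.log (v w τ))) z)) y
        + (2 / Θ₀) * deriv (fun z => z * v z τ) y)
    (hdens : ∀ τ ∈ Ioo 0 T,
      Integrable (fun y => v y τ) ∧ (∫ y : ℝ, v y τ) = 1)
    (hdecay : ∀ τ ∈ Ioo 0 T, RapidDecay (fun y => v y τ))
    (hI : ∀ τ ∈ Ioo 0 T,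
      Integrable (fun y => v y τ * (deriv (fun z => Real.log (v z τ)) y) ^ 2) ∧
      0 < fisher (fun y => v y τ))
    (hmom : ∀ τ ∈ Ioo 0 T,
      Integrable (fun y => y ^ 2 * v y τ) ∧ (∫ y : ℝ, y ^ 2 * v y τ) = Θ₀) :
    ∀ τ ∈ Ioo 0 T,
      deriv (fun s => relBoltzmann Θ₀ (fun y => v y s)) τ ≤
        -(2 / Θ₀) * (Real.exp (2 * relBoltzmann Θ₀ (fun y => v y τ)) - 1) := by
  set L : ℝ × ℝ → ℝ := fun p => Real.log (v p.1 p.2)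
  have sL : SmoothOnSlab T L := ContDiffOn.log hsmooth fun p hp => (hpos p.1 p.2 hp.2).ne'
  have hexp : ∀ s ∈ Ioo 0 T, ∀ y, Real.exp (L (y, s)) = v y s := fun s hs y =>
    Real.exp_log (hpos y s hs)
  have hd1 : ∀ s ∈ Ioo 0 T, deriv (fun z => Real.log (v z s)) = fun y => spaceDeriv L (y, s) :=
    fun s hs => funext fun y => (sL.hasDerivAt_space hs y).deriv
  have hfisher : ∀ s ∈ Ioo 0 T, fisher (fun y => v y s) = 1 / 2 * fisherIntegral L s :=
    fun s hs => by simp only [fisher, fisherIntegral, hexp s hs, hd1 s hs]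
  have hJ : ∀ s ∈ Ioo 0 T, 0 < fisherIntegral L s := fun s hs => by
    have := (hI s hs).2
    rw [hfisher s hs] at this
    linarith
  have hsol : IsLogSolution (2 / Θ₀) Θ₀ T L := by
    refine ⟨sL, fun s hs y => ?_, fun s hs => ?_, fun s hs => ?_, fun s hs => ?_, fun s hs => ?_,
      hJ, fun s hs => ?_, fun s hs => ?_⟩
    · have sP : SmoothOnSlab T fun p => Real.exp (L p) * bohmForce L p :=
        sL.exp.mul (sL.spaceDeriv.spaceDeriv.spaceDeriv.add
          (sL.spaceDeriv.mul sL.spaceDeriv.spaceDeriv))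
      have hd2 : deriv (fun z => v z s * deriv (deriv fun w => Real.log (v w s)) z) =
          fun z => Real.exp (L (z, s)) * bohmForce L (z, s) := by
        have e : (fun z => v z s * deriv (deriv fun w => Real.log (v w s)) z) =
            fun z => Real.exp (L (z, s)) * spaceDeriv (spaceDeriv L) (z, s) := by
          rw [hd1 s hs]
          funext z
          rw [hexp s hs, (sL.spaceDeriv.hasDerivAt_space hs z).deriv]
        rw [e]
        funext z
        refine HasDerivAt.deriv (((sL.hasDerivAt_space hs z).exp.mul
          (sL.spaceDeriv.spaceDeriv.hasDerivAt_space hs z)).congr_deriv ?_)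
        rw [bohmForce]
        ring
      have hd3 : HasDerivAt (fun z => z * Real.exp (L (z, s)))
          (1 * Real.exp (L (y, s)) + y * (Real.exp (L (y, s)) * spaceDeriv L (y, s))) y :=
        (hasDerivAt_id y).mul (sL.hasDerivAt_space hs y).exp
      have hdt : deriv (fun t => v y t) s = Real.exp (L (y, s)) * timeDeriv L (y, s) := by
        refine ((sL.hasDerivAt_time hs y).exp.congr_of_eventuallyEq ?_).deriv
        filter_upwards [isOpen_Ioo.mem_nhds hs] with t ht using (hexp t ht y).symm
      have hp := hpde y s hs
      have hzv : (fun z => z * v z s) = fun z => z * Real.exp (L (z, s)) :=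
        funext fun z => by rw [hexp s hs]
      rw [hdt, hd2, (sP.hasDerivAt_space hs y).deriv, hfisher s hs, hzv, hd3.deriv] at hp
      have hflux := ((sP.hasDerivAt_space hs y).const_mul (2 / fisherIntegral L s)).sub
        (hd3.const_mul (2 / Θ₀))
      refine (hflux.congr_of_eventuallyEq (Eventually.of_forall fun z => ?_)).congr_deriv ?_
      · simp only [Pi.sub_apply]
        ring
      · have e : 1 / (1 / 2 * fisherIntegral L s) = 2 / fisherIntegral L s := by
          have := (hJ s hs).ne'
          field_simp
        rw [hp, e]
        ring
    · simpa only [hexp s hs] using (hdens s hs).1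
    · simpa only [hexp s hs] using (hdens s hs).2
    · simpa only [hexp s hs, pow_zero, one_mul, iteratedDeriv_zero] using
        (hdecay s hs 0 0).mono_left atBot_le_cocompact
    · simpa only [hexp s hs, hd1 s hs] using (hI s hs).1
    · simpa only [hexp s hs, mul_comm] using (hmom s hs).1
    · simpa only [hexp s hs, mul_comm] using (hmom s hs).2
  intro τ hτ
  obtain ⟨D, hD, hle⟩ := hsol.exists_hasDerivAt_entropy_le (by positivity) hτ
  have hrel : ∀ s ∈ Ioo 0 T, relBoltzmann Θ₀ (fun y => v y s) =
      1 / 2 * Real.log (2 * Real.pi * Real.exp 1 * Θ₀) +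
        ∫ y, Real.exp (L (y, s)) * L (y, s) := fun s hs => by
    simp only [relBoltzmann, hexp s hs]
    rfl
  have hderiv : HasDerivAt (fun s => relBoltzmann Θ₀ (fun y => v y s)) D τ :=
    (hD.const_add _).congr_of_eventuallyEq
      (by filter_upwards [isOpen_Ioo.mem_nhds hτ] with s hs using hrel s hs)
  rw [hderiv.deriv, hrel τ hτ]
  have hls := hsol.exp_two_mul_entropy_le hΘ₀ hτ
  have hmul := mul_le_mul_of_nonneg_left hls (show 0 ≤ 2 / Θ₀ by positivity)
  have e : 2 / Θ₀ * (Θ₀ * fisherIntegral L τ) = 2 * fisherIntegral L τ := by field_simp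
  linarith
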